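/- For every deterministic initial state 𝒳(0) = (x, i) ∈ 𝒵^m, almost surely (1/N) Σ_{ι=1}^{N} ( R(τ_ι)/v_{l(τ_ι)} − R(σ_ι)/v_{l(σ_ι)} ) → μ as N → ∞, where μ = E_{π_entrance}[R(0)/v_{l(0)}] − E_{π_exit}[R(0)/v_{l(0)}] ∈ (0, ∞). -/

import Mathlib

open MeasureTheory Filter
open scoped ENNReal

/-- `sigmaT ι ω = σ_{ι+1}(ω)`: the `(ι+1)`-st exit time of the radius from `ℕ`
along a trajectory `ω` in `ℤ × {1,…,m}`, i.e. `σ₁ = inf {k ≥ 0 : R(k) ≤ 0}`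
and `σ_{ι+1} = inf {k > σ_ι : R(k) ≤ 0}`. -/
noncomputable def sigmaT {m : ℕ} : ℕ → (ℕ → ℤ × Fin m) → ℕ
  | 0, ω => sInf {k : ℕ | (ω k).1 ≤ 0}
  | ι + 1, ω => sInf {k : ℕ | sigmaT ι ω < k ∧ (ω k).1 ≤ 0}

/-- The `n`-step transition probabilities of the kernel `K`. -/
noncomputable def iterK {m : ℕ} (K : ℤ × Fin m → PMF (ℤ × Fin m)) :
    ℕ → ℤ × Fin m → PMF (ℤ × Fin m)
  | 0, s => PMF.pure s
  | n + 1, s => (iterK K n s).bind K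

/-- `π` is a stationary distribution of the embedded exit chain
`𝒳_exit(ι) = 𝒳(σ_ι)`: a probability distribution on the state space
`{…,−1,0} × {1,…,m}` of that chain which is invariant under its transition
kernel (from an exit state `s` the next exit value is `ω(σ₂)` under `P s`). -/
def ExitStationary {m : ℕ} (P : ℤ × Fin m → Measure (ℕ → ℤ × Fin m))
    (π : Measure (ℤ × Fin m)) : Prop :=
  IsProbabilityMeasure π ∧ π {s : ℤ × Fin m | 1 ≤ s.1} = 0 ∧
  ∀ A : Set (ℤ × Fin m),
    ∑' s : ℤ × Fin m, π {s} * P s {ω | ω (sigmaT 1 ω) ∈ A} = π A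

/-- `π` is a stationary distribution of the embedded entrance chain
`𝒳_entrance(ι) = 𝒳(τ_ι) = 𝒳(σ_ι + 1)`: a probability distribution on the
state space `ℕ × {1,…,m}` of that chain which is invariant under its
transition kernel (from an entrance state `s` the next entrance value is
`ω(σ₁ + 1)` under `P s`). -/
def EntranceStationary {m : ℕ} (P : ℤ × Fin m → Measure (ℕ → ℤ × Fin m))
    (π : Measure (ℤ × Fin m)) : Prop :=
  IsProbabilityMeasure π ∧ π {s : ℤ × Fin m | s.1 ≤ 0} = 0 ∧
  ∀ A : Set (ℤ × Fin m),
    ∑' s : ℤ × Fin m, π {s} * P s {ω | ω (sigmaT 0 ω + 1) ∈ A} = π A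

section PartA
open scoped NNReal

open scoped ENNReal

section PathMeasure

set_option linter.unusedSectionVars false

/-- prepend a state to a path -/
def cns {E : Type*} (s : E) (ω : ℕ → E) : ℕ → E
  | 0 => s
  | k + 1 => ω k

/-- shift a path -/
def shf {E : Type*} (n : ℕ) (ω : ℕ → E) : ℕ → E := fun k => ω (n + k)

variable {E : Type*} [MeasurableSpace E] [DiscreteMeasurableSpace E] [Countable E]

theorem measurable_cns (s : E) : Measurable (cns s) := by
  rw [measurable_pi_iff]
  intro k
  cases k with
  | zero => exact measurable_const
  | succ k => exact measurable_pi_apply k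

theorem measurable_shf (n : ℕ) : Measurable (shf (E := E) n) := by
  rw [measurable_pi_iff]
  intro k
  exact measurable_pi_apply (n + k)

theorem mset_coord (k : ℕ) (A : Set E) : MeasurableSet {ω : ℕ → E | ω k ∈ A} := by
  have h : Measurable (fun ω : ℕ → E => ω k) := measurable_pi_apply k
  exact h (MeasurableSet.of_discrete (s := A))

theorem path_measure_ext (μ ν : Measure (ℕ → E)) [IsFiniteMeasure μ] [IsFiniteMeasure ν]
    (h : ∀ (n : ℕ) (path : ℕ → E), μ {ω | ∀ k ≤ n, ω k = path k} = ν {ω | ∀ k ≤ n, ω k = path k}) :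
    μ = ν := by
  have hfam : IsProjectiveMeasureFamily (α := fun _ : ℕ => E) (fun I : Finset ℕ => μ.map (I.restrict (π := fun _ => E))) := by
    intro I J hJI
    simp only
    rw [Measure.map_map (by fun_prop) (by fun_prop)]
    rfl
  have h1 : IsProjectiveLimit (α := fun _ : ℕ => E) μ (fun I : Finset ℕ => μ.map (I.restrict (π := fun _ => E))) := fun I => rfl
  refine h1.unique ?_
  rw [isProjectiveLimit_nat_iff hfam]
  intro n
  symm
  refine Measure.ext_of_singleton ?_
  intro a
  have hm : MeasurableSet ({a} : Set ((i : Finset.Iic n) → E)) := measurableSet_singleton a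
  rw [Measure.map_apply (by fun_prop) hm, Measure.map_apply (by fun_prop) hm]
  have e : ∃ path : ℕ → E, ∀ i : Finset.Iic n, path i = a i := by
    refine ⟨fun k => if hk : k ≤ n then a ⟨k, Finset.mem_Iic.2 hk⟩ else a ⟨0, by simp⟩, ?_⟩
    intro i
    have := Finset.mem_Iic.1 i.2
    simp [this]
  obtain ⟨path, hp⟩ := e
  have e1 : (Finset.Iic n).restrict (π := fun _ => E) ⁻¹' {a} = {ω | ∀ k ≤ n, ω k = path k} := by
    ext ω
    simp only [Set.mem_preimage, Set.mem_singleton_iff, Set.mem_ofPred_eq]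
    constructor
    · intro hh k hk
      have := congrFun hh ⟨k, Finset.mem_Iic.2 hk⟩
      rw [← hp] at this
      simpa using this
    · intro hh
      funext i
      rw [← hp]
      exact hh i (Finset.mem_Iic.1 i.2)
  have e2 : Preorder.frestrictLe (π := fun _ => E) n ⁻¹' {a} = {ω | ∀ k ≤ n, ω k = path k} := e1
  rw [e2, e1]
  exact h n path

/-- `P s` is the law of the chain with kernel `K` started at `s`. -/
structure MC (K : E → PMF E) (P : E → Measure (ℕ → E)) : Prop where
  prob : ∀ s, IsProbabilityMeasure (P s)
  cyl0 : ∀ (s : E) (n : ℕ) (path : ℕ → E), path 0 ≠ s → P s {ω | ∀ k ≤ n, ω k = path k} = 0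
  cyl1 : ∀ (n : ℕ) (path : ℕ → E), P (path 0) {ω | ∀ k ≤ n, ω k = path k} =
          ∏ k ∈ Finset.range n, K (path k) (path (k + 1))

variable {K : E → PMF E} {P : E → Measure (ℕ → E)}

theorem measurableSet_cyl (n : ℕ) (path : ℕ → E) : MeasurableSet {ω : ℕ → E | ∀ k ≤ n, ω k = path k} := by
  have : {ω : ℕ → E | ∀ k ≤ n, ω k = path k} = ⋂ k, ⋂ (_ : k ≤ n), (fun ω => ω k) ⁻¹' {path k} := by
    ext; simp
  rw [this]
  refine MeasurableSet.iInter fun k => MeasurableSet.iInter fun _ => ?_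
  exact (measurable_pi_apply k) (MeasurableSet.of_discrete)

theorem MC.step (h : MC K P) (s : E) :
    P s = Measure.sum (fun y => K s y • (P y).map (cns s)) := by
  classical
  have := h.prob
  have hf : Measure.sum (fun y => K s y • (P y).map (cns s)) Set.univ = 1 := by
    rw [Measure.sum_apply _ MeasurableSet.univ]
    simp only [Measure.smul_apply, smul_eq_mul]
    rw [← (K s).tsum_coe]
    refine tsum_congr fun y => ?_
    rw [Measure.map_apply (measurable_cns s) MeasurableSet.univ]
    simp
  have : IsFiniteMeasure (Measure.sum (fun y => K s y • (P y).map (cns s))) := ⟨by rw [hf]; simp⟩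
  refine path_measure_ext _ _ ?_
  intro n path
  rw [Measure.sum_apply _ (measurableSet_cyl n path)]
  simp only [Measure.smul_apply, smul_eq_mul]
  simp_rw [Measure.map_apply (measurable_cns s) (measurableSet_cyl n path)]
  by_cases h0 : path 0 = s
  · subst h0
    cases n with
    | zero =>
      rw [h.cyl1]
      have : cns (path 0) ⁻¹' {ω : ℕ → E | ∀ k ≤ 0, ω k = path k} = Set.univ := by
        ext ω; simp [cns]
      rw [this]
      simp [(K (path 0)).tsum_coe]
    | succ n =>
      rw [h.cyl1]
      have : cns (path 0) ⁻¹' {ω : ℕ → E | ∀ k ≤ n + 1, ω k = path k}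
          = {ω : ℕ → E | ∀ k ≤ n, ω k = path (k + 1)} := by
        ext ω
        simp only [Set.mem_preimage, Set.mem_ofPred_eq]
        constructor
        · intro hh k hk
          exact hh (k + 1) (by omega)
        · intro hh k hk
          cases k with
          | zero => rfl
          | succ k => exact hh k (by omega)
      rw [this, tsum_eq_single (path 1)]
      · rw [h.cyl1 n (fun k => path (k + 1)), Finset.prod_range_succ', mul_comm]
      · intro y hy
        rw [h.cyl0 y n (fun k => path (k + 1)) (Ne.symm hy), mul_zero]
  · rw [h.cyl0 _ _ _ h0]
    have : cns s ⁻¹' {ω : ℕ → E | ∀ k ≤ n, ω k = path k} = ∅ := by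
      ext ω
      simp only [Set.mem_preimage, Set.mem_ofPred_eq, Set.mem_empty_iff_false, iff_false]
      intro hh
      exact h0 (hh 0 (by omega)).symm
    simp [this]

theorem MC.lint (h : MC K P) (s : E) {f : (ℕ → E) → ℝ≥0∞} (hf : Measurable f) :
    ∫⁻ ω, f ω ∂(P s) = ∑' y, K s y * ∫⁻ ω, f (cns s ω) ∂(P y) := by
  rw [h.step s, lintegral_sum_measure]
  refine tsum_congr fun y => ?_
  rw [lintegral_smul_measure, lintegral_map hf (measurable_cns s)]
  rfl

theorem MC.meas (h : MC K P) (s : E) {A : Set (ℕ → E)} (hA : MeasurableSet A) :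
    P s A = ∑' y, K s y * P y (cns s ⁻¹' A) := by
  conv_lhs => rw [h.step s]
  rw [Measure.sum_apply _ hA]
  refine tsum_congr fun y => ?_
  rw [Measure.smul_apply, Measure.map_apply (measurable_cns s) hA]
  rfl

theorem MC.start (h : MC K P) (s : E) : P s {ω | ω 0 = s}ᶜ = 0 := by
  have hm : MeasurableSet {ω : ℕ → E | ω 0 = s} :=
    mset_coord 0 {s}
  rw [h.meas s hm.compl]
  have : cns s ⁻¹' {ω : ℕ → E | ω 0 = s}ᶜ = ∅ := by ext ω; simp [cns]
  simp [this]

theorem MC.start_ae (h : MC K P) (s : E) : ∀ᵐ ω ∂(P s), ω 0 = s := h.start s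

/-- `A` depends only on the coordinates up to `n`. -/
def Dep (n : ℕ) (A : Set (ℕ → E)) : Prop :=
  ∀ ω ω' : ℕ → E, (∀ k ≤ n, ω k = ω' k) → ω ∈ A → ω' ∈ A

theorem MC.markov (h : MC K P) (n : ℕ) (y : E) {B : Set (ℕ → E)} (hB : MeasurableSet B) :
    ∀ (A : Set (ℕ → E)), MeasurableSet A → Dep n A → (∀ ω ∈ A, ω n = y) → ∀ s,
    P s (A ∩ shf n ⁻¹' B) = P s A * P y B := by
  have := h.prob
  induction n with
  | zero =>
    intro A hA hd hy s
    have hsB : shf 0 ⁻¹' B = B := by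
      ext ω
      have : shf 0 ω = ω := by funext k; simp [shf]
      simp [this]
    rw [hsB]
    by_cases hs : ∃ ω ∈ A, ω 0 = s
    · obtain ⟨ω, hω, h0⟩ := hs
      have : s = y := by rw [← h0]; exact hy ω hω
      subst this
      have hae : A =ᵐ[P s] Set.univ := by
        filter_upwards [h.start_ae s] with ω' h'
        have : ω' ∈ A := hd ω ω' (by intro k hk; obtain rfl : k = 0 := by omega
                                     rw [h0, h']) hω
        exact propext ⟨fun _ => trivial, fun _ => this⟩
      rw [measure_congr hae, measure_univ, one_mul]
      refine measure_congr ?_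
      have := hae.inter (ae_eq_refl B)
      simpa using this
    · have : P s A = 0 := by
        refine measure_mono_null ?_ (h.start s)
        intro ω hω h0
        exact hs ⟨ω, hω, h0⟩
      rw [this, zero_mul]
      exact measure_mono_null Set.inter_subset_left this
  | succ n ih =>
    intro A hA hd hy s
    rw [h.meas s (hA.inter (measurable_shf _ hB)), h.meas s hA, ← ENNReal.tsum_mul_right]
    refine tsum_congr fun z => ?_
    have e : cns s ⁻¹' (A ∩ shf (n + 1) ⁻¹' B) = (cns s ⁻¹' A) ∩ shf n ⁻¹' B := by
      ext ω
      have : shf (n + 1) (cns s ω) = shf n ω := by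
        funext k
        have : n + 1 + k = (n + k) + 1 := by omega
        simp only [shf, this, cns]
      simp [this]
    rw [e, ih (cns s ⁻¹' A) (measurable_cns s hA), mul_assoc]
    · intro ω ω' hh hω
      refine hd (cns s ω) (cns s ω') ?_ hω
      intro k hk
      cases k with
      | zero => rfl
      | succ k => exact hh k (by omega)
    · intro ω hω
      exact hy (cns s ω) hω

/-- strong Markov property at a stopping time described by disjoint events `A n`. -/
theorem MC.strong (h : MC K P) (y : E) {B : Set (ℕ → E)} (hB : MeasurableSet B)
    (A : ℕ → Set (ℕ → E)) (hA : ∀ n, MeasurableSet (A n)) (hd : ∀ n, Dep n (A n))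
    (hy : ∀ n, ∀ ω ∈ A n, ω n = y) (hdis : Pairwise (Function.onFun Disjoint A)) (s : E) :
    P s (⋃ n, A n ∩ shf n ⁻¹' B) = P s (⋃ n, A n) * P y B := by
  rw [measure_iUnion, measure_iUnion hdis hA, ← ENNReal.tsum_mul_right]
  · exact tsum_congr fun n => h.markov n y hB (A n) (hA n) (hd n) (hy n) s
  · intro i j hij
    exact (hdis hij).mono Set.inter_subset_left Set.inter_subset_left
  · intro n
    exact (hA n).inter (measurable_shf n hB)

end PathMeasure

end PartA

section PartB
open scoped NNReal

section Recurrence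

set_option linter.unusedSectionVars false

variable {E : Type*} [MeasurableSpace E] [DiscreteMeasurableSpace E] [Countable E]
variable {K : E → PMF E} {P : E → Measure (ℕ → E)}

/-- Lyapunov function for the chain `K` towards the state `s0`. -/
structure Lyap (K : E → PMF E) (s0 : E) (V g : E → ℝ≥0∞) : Prop where
  vfin : ∀ s, V s ≠ ⊤
  gfin : ∀ s, g s ≠ ⊤
  gpos : ∀ s, g s ≠ 0
  sub : ∀ M : ℝ≥0, {s | V s ≤ M}.Finite
  drift : ∀ s, s ≠ s0 → (∑' y, K s y * V y) + g s ≤ V s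
  fin0 : ∑' y, K s0 y * V y ≠ ⊤

theorem Lyap.max_principle {s0 : E} {V g : E → ℝ≥0∞} (L : Lyap K s0 V g) (q : E → ℝ≥0∞)
    (hq1 : ∀ s, q s ≤ 1) (hqK : ∀ s, q s ≤ ∑' y, K s y * q y) (hq0 : q s0 = 0) : ∀ s, q s = 0 := by
  by_contra hcon
  push Not at hcon
  obtain ⟨s1, hs1⟩ := hcon
  have hqf : ∀ s, q s ≠ ⊤ := fun s => ne_top_of_le_ne_top ENNReal.one_ne_top (hq1 s)
  have hq1r : ∀ s, (q s).toReal ≤ 1 := fun s => by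
    have := ENNReal.toReal_mono ENNReal.one_ne_top (hq1 s)
    simpa using this
  have hpos : 0 < (q s1).toReal := ENNReal.toReal_pos hs1 (hqf s1)
  have hV0 : ∀ s, 0 ≤ (V s).toReal := fun s => ENNReal.toReal_nonneg
  obtain ⟨ε, hε, hεV⟩ : ∃ ε : ℝ, 0 < ε ∧ ε * (V s1).toReal < (q s1).toReal := by
    refine ⟨(q s1).toReal / ((V s1).toReal + 1), by have := hV0 s1; positivity, ?_⟩
    have := hV0 s1
    rw [div_mul_eq_mul_div, div_lt_iff₀ (by linarith)]
    nlinarith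
  set w : E → ℝ := fun s => (q s).toReal - ε * (V s).toReal with hw
  have hfin : {s | w s1 ≤ w s}.Finite := by
    refine (L.sub (Real.toNNReal (1 / ε))).subset ?_
    intro s hs
    have hs' : w s1 ≤ w s := hs
    have : 0 < w s1 := by simp only [hw]; linarith
    have h2 : ε * (V s).toReal ≤ 1 := by
      have := hq1r s
      simp only [hw] at *
      linarith
    have h3 : (V s).toReal ≤ 1 / ε := by
      rw [le_div_iff₀ hε]; linarith
    show V s ≤ _
    rw [← ENNReal.ofReal_toReal (L.vfin s)]
    exact ENNReal.ofReal_le_ofReal h3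
  obtain ⟨u, hu, humax⟩ := Set.exists_max_image _ w hfin ⟨s1, le_refl (w s1)⟩
  have hu' : w s1 ≤ w u := hu
  have hall : ∀ y, w y ≤ w u := by
    intro y
    by_cases hy : w s1 ≤ w y
    · exact humax y hy
    · linarith
  have hwu : 0 < w u := by
    have : 0 < w s1 := by simp only [hw]; linarith
    linarith
  have hus0 : u ≠ s0 := by
    rintro rfl
    have : w u ≤ 0 := by
      simp only [hw, hq0]
      have := mul_nonneg hε.le (hV0 u)
      simp; linarith
    linarith
  have hle : ∀ y, q y ≤ ENNReal.ofReal (w u) + ENNReal.ofReal ε * V y := by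
    intro y
    rw [← ENNReal.ofReal_toReal (hqf y), ← ENNReal.ofReal_toReal (L.vfin y),
      ← ENNReal.ofReal_mul hε.le, ← ENNReal.ofReal_add hwu.le (mul_nonneg hε.le (hV0 y))]
    refine ENNReal.ofReal_le_ofReal ?_
    have := hall y
    simp only [hw] at *
    linarith
  have heq : q u = ENNReal.ofReal (w u) + ENNReal.ofReal ε * V u := by
    conv_rhs => rw [← ENNReal.ofReal_toReal (L.vfin u)]
    rw [← ENNReal.ofReal_toReal (hqf u), 
      ← ENNReal.ofReal_mul hε.le, ← ENNReal.ofReal_add hwu.le (mul_nonneg hε.le (hV0 u))]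
    congr 1
    simp only [hw]; ring
  have hdr := L.drift u hus0
  set KV := ∑' y, K u y * V y with hKV
  have hKVfin : KV ≠ ⊤ := ne_top_of_le_ne_top (L.vfin u) (le_trans le_self_add hdr)
  have h1 : q u ≤ ENNReal.ofReal (w u) + ENNReal.ofReal ε * KV := by
    calc q u ≤ ∑' y, K u y * q y := hqK u
      _ ≤ ∑' y, K u y * (ENNReal.ofReal (w u) + ENNReal.ofReal ε * V y) :=
          ENNReal.tsum_le_tsum fun y => mul_le_mul_right (hle y) _
      _ = ∑' y, (K u y * ENNReal.ofReal (w u) + ENNReal.ofReal ε * (K u y * V y)) := by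
          refine tsum_congr fun y => ?_
          ring
      _ = _ := by
          rw [ENNReal.tsum_add, ENNReal.tsum_mul_right, ENNReal.tsum_mul_left, (K u).tsum_coe, one_mul]
  rw [heq] at h1
  have h2 := (ENNReal.add_le_add_iff_left ENNReal.ofReal_ne_top).1 h1
  have h3 := (ENNReal.mul_le_mul_iff_right (by simpa using hε) ENNReal.ofReal_ne_top).1 h2
  have h4 : KV + g u ≤ KV + 0 := by
    rw [add_zero]; exact hdr.trans h3
  have h5 := (ENNReal.add_le_add_iff_left hKVfin).1 h4
  exact L.gpos u (le_antisymm h5 zero_le)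

theorem mset_never (s0 : E) : MeasurableSet {ω : ℕ → E | ∀ k, ω k ≠ s0} := by
  have : {ω : ℕ → E | ∀ k, ω k ≠ s0} = ⋂ k, {ω : ℕ → E | ω k ∈ ({s0}ᶜ : Set E)} := by
    ext; simp
  rw [this]
  exact MeasurableSet.iInter fun k => mset_coord k _

theorem hit_ae (h : MC K P) {s0 : E} {V g : E → ℝ≥0∞} (L : Lyap K s0 V g) (s : E) :
    P s {ω | ∀ k, ω k ≠ s0} = 0 := by
  have := h.prob
  refine L.max_principle (fun s => P s {ω | ∀ k, ω k ≠ s0}) (fun s => prob_le_one) ?_ ?_ s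
  · intro s
    rw [h.meas s (mset_never s0)]
    refine ENNReal.tsum_le_tsum fun y => mul_le_mul_right (measure_mono ?_) _
    intro ω hω k
    exact hω (k + 1)
  · refine measure_mono_null ?_ (h.start s0)
    intro ω hω h0
    exact hω 0 h0

/-- event: the first return to `s0` takes place at time `n` -/
def Ret (s0 : E) (n : ℕ) : Set (ℕ → E) :=
  {ω | 1 ≤ n ∧ ω n = s0 ∧ ∀ k, 1 ≤ k → k < n → ω k ≠ s0}

theorem mset_ret (s0 : E) (n : ℕ) : MeasurableSet (Ret s0 n) := by
  have : Ret s0 n = {ω | 1 ≤ n} ∩ ({ω | ω n ∈ ({s0} : Set E)} ∩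
      ⋂ k, ⋂ (_ : 1 ≤ k), ⋂ (_ : k < n), {ω : ℕ → E | ω k ∈ ({s0}ᶜ : Set E)}) := by
    ext; simp [Ret]
  rw [this]
  refine (MeasurableSet.const _).inter ((mset_coord _ _).inter ?_)
  exact MeasurableSet.iInter fun k => MeasurableSet.iInter fun _ => MeasurableSet.iInter fun _ => mset_coord k _

theorem ret_disjoint (s0 : E) : Pairwise (Function.onFun Disjoint (Ret s0)) := by
  intro i j hij
  refine Set.disjoint_left.2 ?_
  rintro ω ⟨h1, h2, h3⟩ ⟨h1', h2', h3'⟩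
  rcases lt_or_gt_of_ne hij with h | h
  · exact h3' i h1 h h2
  · exact h3 j h1' h h2'

/-- first return time -/
noncomputable def rt (s0 : E) (ω : ℕ → E) : ℕ := sInf {k | 1 ≤ k ∧ ω k = s0}

theorem rt_of_ret {s0 : E} {n : ℕ} {ω : ℕ → E} (h : ω ∈ Ret s0 n) : rt s0 ω = n := by
  obtain ⟨h1, h2, h3⟩ := h
  refine le_antisymm (Nat.sInf_le ⟨h1, h2⟩) ?_
  by_contra hlt
  push Not at hlt
  have hne : {k | 1 ≤ k ∧ ω k = s0}.Nonempty := ⟨n, h1, h2⟩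
  have := Nat.sInf_mem hne
  exact h3 _ this.1 hlt this.2

theorem ret_of_ex {s0 : E} {ω : ℕ → E} (h : ∃ k, 1 ≤ k ∧ ω k = s0) : ω ∈ Ret s0 (rt s0 ω) := by
  have := Nat.sInf_mem h
  refine ⟨this.1, this.2, ?_⟩
  intro k hk hlt hks
  exact Nat.notMem_of_lt_sInf hlt ⟨hk, hks⟩

theorem ret_ae (h : MC K P) {s0 : E} {V g : E → ℝ≥0∞} (L : Lyap K s0 V g) (s : E) :
    ∀ᵐ ω ∂(P s), ω ∈ ⋃ n, Ret s0 n := by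
  have hm : MeasurableSet (⋃ n, Ret s0 n) := MeasurableSet.iUnion (mset_ret s0)
  show P s (⋃ n, Ret s0 n)ᶜ = 0
  rw [h.meas s hm.compl]
  simp only [ENNReal.tsum_eq_zero]
  intro y
  rw [measure_mono_null ?_ (hit_ae h L y), mul_zero]
  intro ω hω k hk
  refine hω ?_
  have : ∃ k, 1 ≤ k ∧ (cns s ω) k = s0 := ⟨k + 1, by omega, hk⟩
  exact Set.mem_iUnion.2 ⟨_, ret_of_ex this⟩

/-- the block return map -/
noncomputable def Phi (s0 : E) (ω : ℕ → E) : ℕ → E := shf (rt s0 ω) ω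

open Classical in
/-- cost collected until the first return to `s0` -/
noncomputable def Wc (s0 : E) (c : E → E → ℝ≥0∞) (ω : ℕ → E) : ℝ≥0∞ :=
  ∑' k, if ∀ j, 1 ≤ j → j ≤ k → ω j ≠ s0 then c (ω k) (ω (k + 1)) else 0

theorem mset_noret (s0 : E) (k : ℕ) : MeasurableSet {ω : ℕ → E | ∀ j, 1 ≤ j → j ≤ k → ω j ≠ s0} := by
  have : {ω : ℕ → E | ∀ j, 1 ≤ j → j ≤ k → ω j ≠ s0} =
      ⋂ j, ⋂ (_ : 1 ≤ j), ⋂ (_ : j ≤ k), {ω : ℕ → E | ω j ∈ ({s0}ᶜ : Set E)} := by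
    ext; simp
  rw [this]
  exact MeasurableSet.iInter fun k => MeasurableSet.iInter fun _ => MeasurableSet.iInter fun _ => mset_coord k _

theorem meas_pair {α : Type*} [MeasurableSpace α] (c : E → E → α) (i j : ℕ) :
    Measurable (fun ω : ℕ → E => c (ω i) (ω j)) := by
  have h1 : Measurable (fun p : E × E => c p.1 p.2) := .of_discrete
  have h2 : Measurable (fun ω : ℕ → E => ((ω i, ω j) : E × E)) := by fun_prop
  exact h1.comp h2

theorem meas_Wterm (s0 : E) (c : E → E → ℝ≥0∞) (k : ℕ) : 
    Measurable (fun ω : ℕ → E => open Classical in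
      if ∀ j, 1 ≤ j → j ≤ k → ω j ≠ s0 then c (ω k) (ω (k + 1)) else 0) := by
  classical
  exact Measurable.ite (mset_noret s0 k) (meas_pair c k (k + 1)) measurable_const

theorem meas_Wc (s0 : E) (c : E → E → ℝ≥0∞) : Measurable (Wc s0 c) :=
  Measurable.tsum fun k => meas_Wterm s0 c k

theorem Wc_of_ret {s0 : E} {n : ℕ} {ω : ℕ → E} (c : E → E → ℝ≥0∞) (h : ω ∈ Ret s0 n) :
    Wc s0 c ω = ∑ k ∈ Finset.range n, c (ω k) (ω (k + 1)) := by
  obtain ⟨h1, h2, h3⟩ := h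
  rw [Wc, tsum_eq_sum (s := Finset.range n)]
  · refine Finset.sum_congr rfl fun k hk => ?_
    rw [if_pos]
    intro j hj hjk
    exact h3 j hj (lt_of_le_of_lt hjk (Finset.mem_range.1 hk))
  · intro k hk
    rw [if_neg]
    intro hh
    exact hh n h1 (by simpa using hk) h2

theorem Wc_int_fin (h : MC K P) {s0 : E} {V g : E → ℝ≥0∞} (L : Lyap K s0 V g)
    (c : E → E → ℝ≥0∞) (κ : ℝ≥0∞) (hκ : κ ≠ ⊤) (hc : ∀ s, ∑' y, K s y * c s y ≤ κ * g s) :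
    ∫⁻ ω, Wc s0 c ω ∂(P s0) ≠ ⊤ := by
  classical
  have := h.prob
  set Ln : ℕ → (ℕ → E) → ℝ≥0∞ := fun n ω => ∑ k ∈ Finset.range n,
    if ∀ j, 1 ≤ j → j ≤ k → ω j ≠ s0 then c (ω k) (ω (k + 1)) else 0 with hLn
  have hmeas : ∀ n, Measurable (Ln n) := fun n =>
    Finset.measurable_sum _ fun k _ => meas_Wterm s0 c k
  have hcons : ∀ n s ω, Ln (n + 1) (cns s ω) = c s (ω 0) + if ω 0 ≠ s0 then Ln n ω else 0 := by
    intro n s ω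
    simp only [hLn]
    rw [Finset.sum_range_succ', add_comm]
    congr 1
    · rw [if_pos]
      · rfl
      · intro j hj hj'; omega
    · split_ifs with h0
      · refine Finset.sum_congr rfl fun k _ => ?_
        have : (∀ j, 1 ≤ j → j ≤ k + 1 → cns s ω j ≠ s0) ↔ (∀ j, 1 ≤ j → j ≤ k → ω j ≠ s0) := by
          constructor
          · intro hh j hj hjk
            exact hh (j + 1) (by omega) (by omega)
          · intro hh j hj hjk
            obtain ⟨i, rfl⟩ : ∃ i, j = i + 1 := ⟨j - 1, by omega⟩
            by_cases hi : i = 0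
            · subst hi; exact h0
            · exact hh i (by omega) (by omega)
        by_cases hA : ∀ j, 1 ≤ j → j ≤ k → ω j ≠ s0
        · rw [if_pos hA, if_pos (this.2 hA)]
          rfl
        · rw [if_neg hA, if_neg (fun h => hA (this.1 h))]
      · refine Finset.sum_eq_zero fun k _ => ?_
        rw [if_neg]
        intro hh
        exact h0 (hh 1 (by omega) (by omega))
  have hstep : ∀ n s, ∫⁻ ω, Ln (n + 1) ω ∂(P s) =
      ∑' y, K s y * (c s y + if y ≠ s0 then ∫⁻ ω, Ln n ω ∂(P y) else 0) := by
    intro n s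
    rw [h.lint s (hmeas _)]
    refine tsum_congr fun y => ?_
    congr 1
    have : ∀ᵐ ω ∂(P y), Ln (n + 1) (cns s ω) = c s y + if y ≠ s0 then Ln n ω else 0 := by
      filter_upwards [h.start_ae y] with ω hω
      rw [hcons, hω]
    rw [lintegral_congr_ae this, lintegral_add_left measurable_const]
    congr 1
    · simp
    · split_ifs <;> simp
  have hbound : ∀ n s, s ≠ s0 → ∫⁻ ω, Ln n ω ∂(P s) ≤ κ * V s := by
    intro n
    induction n with
    | zero => intro s _; simp [hLn]
    | succ n ih =>
      intro s hs
      rw [hstep]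
      calc _ ≤ ∑' y, (K s y * c s y + κ * (K s y * V y)) := by
            refine ENNReal.tsum_le_tsum fun y => ?_
            rw [mul_add, mul_left_comm κ]
            gcongr
            split_ifs with hy
            · exact ih y hy
            · exact zero_le
        _ = (∑' y, K s y * c s y) + κ * ∑' y, K s y * V y := by
            rw [ENNReal.tsum_add, ENNReal.tsum_mul_left]
        _ ≤ κ * g s + κ * ∑' y, K s y * V y := by gcongr; exact hc s
        _ = κ * ((∑' y, K s y * V y) + g s) := by ring
        _ ≤ κ * V s := by gcongr; exact L.drift s hs
  have hbound0 : ∀ n, ∫⁻ ω, Ln n ω ∂(P s0) ≤ κ * g s0 + κ * ∑' y, K s0 y * V y := by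
    intro n
    cases n with
    | zero => simp [hLn]
    | succ n =>
      rw [hstep]
      calc _ ≤ ∑' y, (K s0 y * c s0 y + κ * (K s0 y * V y)) := by
            refine ENNReal.tsum_le_tsum fun y => ?_
            rw [mul_add, mul_left_comm κ]
            gcongr
            split_ifs with hy
            · exact hbound n y hy
            · exact zero_le
        _ = (∑' y, K s0 y * c s0 y) + κ * ∑' y, K s0 y * V y := by
            rw [ENNReal.tsum_add, ENNReal.tsum_mul_left]
        _ ≤ κ * g s0 + κ * ∑' y, K s0 y * V y := by gcongr; exact hc s0
  have hW : ∫⁻ ω, Wc s0 c ω ∂(P s0) ≤ κ * g s0 + κ * ∑' y, K s0 y * V y := by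
    unfold Wc
    rw [lintegral_tsum (fun k => (meas_Wterm s0 c k).aemeasurable)]
    rw [ENNReal.tsum_eq_iSup_nat]
    refine iSup_le fun n => ?_
    rw [← lintegral_finsetSum _ (fun k _ => meas_Wterm s0 c k)]
    exact hbound0 n
  refine ne_top_of_le_ne_top ?_ hW
  exact ENNReal.add_ne_top.2 ⟨ENNReal.mul_ne_top hκ (L.gfin s0), ENNReal.mul_ne_top hκ L.fin0⟩

end Recurrence

end PartB

section PartC
open scoped NNReal

section Blocks

set_option linter.unusedSectionVars false

variable {E : Type*} [MeasurableSpace E] [DiscreteMeasurableSpace E] [Countable E]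
variable {K : E → PMF E} {P : E → Measure (ℕ → E)}

theorem meas_sInf (p : ℕ → (ℕ → E) → Prop) (hp : ∀ k, MeasurableSet {ω | p k ω}) :
    Measurable (fun ω => sInf {k | p k ω}) := by
  refine measurable_to_countable' fun n => ?_
  have : (fun ω => sInf {k | p k ω}) ⁻¹' {n} =
      ({ω | p n ω} ∩ ⋂ k, ⋂ (_ : k < n), {ω | p k ω}ᶜ) ∪ ({ω | n = 0} ∩ ⋂ k, {ω | p k ω}ᶜ) := by
    ext ω
    simp only [Set.mem_preimage, Set.mem_singleton_iff, Set.mem_union, Set.mem_inter_iff,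
      Set.mem_iInter, Set.mem_compl_iff, Set.mem_ofPred_eq]
    constructor
    · rintro rfl
      by_cases hne : {k | p k ω}.Nonempty
      · left
        exact ⟨Nat.sInf_mem hne, fun k hk => Nat.notMem_of_lt_sInf hk⟩
      · right
        rw [Set.not_nonempty_iff_eq_empty] at hne
        constructor
        · rw [hne]; exact Nat.sInf_empty
        · intro k hk
          have : k ∈ {k | p k ω} := hk
          rw [hne] at this
          exact this
    · rintro (⟨h1, h2⟩ | ⟨h1, h2⟩)
      · refine le_antisymm (Nat.sInf_le h1) ?_
        by_contra hlt
        push Not at hlt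
        exact h2 _ hlt (Nat.sInf_mem (s := {k | p k ω}) ⟨n, h1⟩)
      · have : {k | p k ω} = ∅ := by
          ext k; simpa using h2 k
        rw [this, h1]; exact Nat.sInf_empty
  rw [this]
  refine ((hp n).inter ?_).union ((MeasurableSet.const _).inter ?_)
  · exact MeasurableSet.iInter fun k => MeasurableSet.iInter fun _ => (hp k).compl
  · exact MeasurableSet.iInter fun k => (hp k).compl

theorem meas_at {N : (ℕ → E) → ℕ} (hN : Measurable N) : Measurable (fun ω : ℕ → E => ω (N ω)) := by
  intro A _
  have : (fun ω : ℕ → E => ω (N ω)) ⁻¹' A = ⋃ n, (N ⁻¹' {n} ∩ {ω | ω n ∈ A}) := by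
    ext ω; simp
  rw [this]
  exact MeasurableSet.iUnion fun n => (hN (measurableSet_singleton n)).inter (mset_coord n A)

theorem meas_rt (s0 : E) : Measurable (rt s0) := by
  refine meas_sInf (fun k ω => 1 ≤ k ∧ ω k = s0) fun k => ?_
  exact (MeasurableSet.const (1 ≤ k)).inter (mset_coord k {s0})

theorem meas_Phi (s0 : E) : Measurable (Phi s0) := by
  rw [measurable_pi_iff]
  intro k
  exact meas_at ((meas_rt s0).add_const k)

theorem dep_ret (s0 : E) (n : ℕ) : Dep n (Ret s0 n) := by
  rintro ω ω' hh ⟨h1, h2, h3⟩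
  refine ⟨h1, by rw [← hh n le_rfl]; exact h2, fun k hk hkn => ?_⟩
  rw [← hh k hkn.le]
  exact h3 k hk hkn

theorem block_meas (h : MC K P) {s0 : E} {V g : E → ℝ≥0∞} (L : Lyap K s0 V g)
    (c : E → E → ℝ≥0∞) {S : Set ℝ≥0∞} (hS : MeasurableSet S) {B : Set (ℕ → E)}
    (hB : MeasurableSet B) :
    P s0 (Wc s0 c ⁻¹' S ∩ Phi s0 ⁻¹' B) = P s0 (Wc s0 c ⁻¹' S) * P s0 B := by
  have hae := ret_ae h L s0
  have key := h.strong s0 hB (fun n => Ret s0 n ∩ Wc s0 c ⁻¹' S)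
    (fun n => (mset_ret s0 n).inter (meas_Wc s0 c hS)) ?_ ?_ ?_ s0
  · have e1 : (⋃ n, Ret s0 n ∩ Wc s0 c ⁻¹' S) =ᵐ[P s0] Wc s0 c ⁻¹' S := by
      filter_upwards [hae] with ω hω
      refine propext ⟨fun hh => ?_, fun hh => ?_⟩
      · obtain ⟨n, hn⟩ := Set.mem_iUnion.1 hh
        exact hn.2
      · obtain ⟨n, hn⟩ := Set.mem_iUnion.1 hω
        exact Set.mem_iUnion.2 ⟨n, hn, hh⟩
    have e2 : (⋃ n, (Ret s0 n ∩ Wc s0 c ⁻¹' S) ∩ shf n ⁻¹' B) =ᵐ[P s0]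
        (Wc s0 c ⁻¹' S ∩ Phi s0 ⁻¹' B : Set (ℕ → E)) := by
      filter_upwards [hae] with ω hω
      refine propext ⟨fun hh => ?_, fun hh => ?_⟩
      · obtain ⟨n, hn⟩ := Set.mem_iUnion.1 hh
        refine ⟨hn.1.2, ?_⟩
        show shf (rt s0 ω) ω ∈ B
        rw [rt_of_ret hn.1.1]
        exact hn.2
      · obtain ⟨n, hn⟩ := Set.mem_iUnion.1 hω
        refine Set.mem_iUnion.2 ⟨n, ⟨hn, hh.1⟩, ?_⟩
        have : shf (rt s0 ω) ω ∈ B := hh.2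
        rw [rt_of_ret hn] at this
        exact this
    rw [← measure_congr e1, ← measure_congr e2]
    exact key
  · rintro n ω ω' hh ⟨h1, h2⟩
    have h1' := dep_ret s0 n ω ω' hh h1
    refine ⟨h1', ?_⟩
    show Wc s0 c ω' ∈ S
    have h2' : Wc s0 c ω ∈ S := h2
    rw [Wc_of_ret c h1'] 
    rw [Wc_of_ret c h1] at h2'
    convert h2' using 1
    refine Finset.sum_congr rfl fun k hk => ?_
    have := Finset.mem_range.1 hk
    rw [hh k (by omega), hh (k + 1) (by omega)]
  · rintro n ω ⟨h1, _⟩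
    exact h1.2.1
  · intro i j hij
    exact (ret_disjoint s0 hij).mono Set.inter_subset_left Set.inter_subset_left

theorem phi_mp (h : MC K P) {s0 : E} {V g : E → ℝ≥0∞} (L : Lyap K s0 V g) :
    MeasurePreserving (Phi s0) (P s0) (P s0) := by
  have := h.prob
  refine ⟨meas_Phi s0, ?_⟩
  ext B hB
  rw [Measure.map_apply (meas_Phi s0) hB]
  have := block_meas h L (fun _ _ => 0) MeasurableSet.univ hB
  simpa using this

theorem indep_comp_mp {Ω : Type*} [MeasurableSpace Ω] {μ : Measure Ω} {φ : Ω → Ω}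
    (hφ : MeasurePreserving φ μ μ) {f g : Ω → ℝ} (hf : Measurable f) (hg : Measurable g)
    (hi : ProbabilityTheory.IndepFun f g μ) : ProbabilityTheory.IndepFun (f ∘ φ) (g ∘ φ) μ := by
  rw [ProbabilityTheory.indepFun_iff_measure_inter_preimage_eq_mul] at hi ⊢
  intro s t hs ht
  have := hi s t hs ht
  rw [← hφ.measure_preimage (hf hs).nullMeasurableSet, ← hφ.measure_preimage (hg ht).nullMeasurableSet,
    ← hφ.measure_preimage ((hf hs).inter (hg ht)).nullMeasurableSet] at this
  exact this

theorem block_slln (h : MC K P) {s0 : E} {V g : E → ℝ≥0∞} (L : Lyap K s0 V g)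
    (c : E → E → ℝ≥0∞) (hfin : ∫⁻ ω, Wc s0 c ω ∂(P s0) ≠ ⊤) :
    ∀ᵐ ω ∂(P s0), Tendsto
      (fun n : ℕ => (∑ i ∈ Finset.range n, (Wc s0 c ((Phi s0)^[i] ω)).toReal) / n) atTop
      (nhds (∫⁻ ω, Wc s0 c ω ∂(P s0)).toReal) := by
  have hp := h.prob
  have hmp := phi_mp h L
  set X : ℕ → (ℕ → E) → ℝ := fun i ω => (Wc s0 c ((Phi s0)^[i] ω)).toReal with hX
  have hX0 : Measurable (X 0) := (meas_Wc s0 c).ennreal_toReal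
  have hXm : ∀ i, Measurable (X i) := fun i => hX0.comp (hmp.iterate i).measurable
  have hint : Integrable (X 0) (P s0) := integrable_toReal_of_lintegral_ne_top (meas_Wc s0 c).aemeasurable hfin
  have hE : ∫ ω, X 0 ω ∂(P s0) = (∫⁻ ω, Wc s0 c ω ∂(P s0)).toReal := by
    refine integral_toReal (meas_Wc s0 c).aemeasurable ?_
    exact ae_lt_top (meas_Wc s0 c) hfin
  rw [← hE]
  have hlt : ∀ i j, i < j → ProbabilityTheory.IndepFun (X i) (X j) (P s0) := by
    intro i j hij
    have hb : ProbabilityTheory.IndepFun (X 0) (X (j - i)) (P s0) := by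
      obtain ⟨d, hd⟩ : ∃ d, j - i = d + 1 := ⟨j - i - 1, by omega⟩
      rw [hd, ProbabilityTheory.indepFun_iff_measure_inter_preimage_eq_mul]
      intro s t hs ht
      have e1 : X 0 ⁻¹' s = Wc s0 c ⁻¹' (ENNReal.toReal ⁻¹' s) := rfl
      have e2 : X (d + 1) ⁻¹' t = Phi s0 ⁻¹' (X d ⁻¹' t) := rfl
      rw [e1, e2, block_meas h L c (ENNReal.measurable_toReal hs) (hXm d ht),
        hmp.measure_preimage (hXm d ht).nullMeasurableSet]
    have := indep_comp_mp (hmp.iterate i) hX0 (hXm (j - i)) hb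
    have e1 : X 0 ∘ (Phi s0)^[i] = X i := rfl
    have e2 : X (j - i) ∘ (Phi s0)^[i] = X j := by
      funext ω
      simp only [hX, Function.comp]
      rw [← Function.iterate_add_apply, Nat.sub_add_cancel hij.le]
    rw [e1, e2] at this
    exact this
  refine ProbabilityTheory.strong_law_ae_real X hint ?_ ?_
  · intro i j hij
    rcases lt_or_gt_of_ne hij with hh | hh
    · exact hlt i j hh
    · exact (hlt j i hh).symm
  · intro i
    refine ⟨(hXm i).aemeasurable, hX0.aemeasurable, ?_⟩
    have : X i = X 0 ∘ (Phi s0)^[i] := rfl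
    rw [this, ← Measure.map_map hX0 (hmp.iterate i).measurable, (hmp.iterate i).map_eq]

/-- return times -/
noncomputable def tj (s0 : E) (ω : ℕ → E) : ℕ → ℕ
  | 0 => 0
  | J + 1 => tj s0 ω J + rt s0 (shf (tj s0 ω J) ω)

theorem shf_shf (a b : ℕ) (ω : ℕ → E) : shf a (shf b ω) = shf (b + a) ω := by
  funext k; simp [shf, add_assoc]

theorem phi_iter (s0 : E) (ω : ℕ → E) (J : ℕ) : (Phi s0)^[J] ω = shf (tj s0 ω J) ω := by
  induction J with
  | zero => funext k; simp [shf, tj]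
  | succ J ih =>
    rw [Function.iterate_succ_apply', ih, Phi, shf_shf]
    rfl

/-- additive functional -/
noncomputable def Af (c : E → E → ℝ≥0) (n : ℕ) (ω : ℕ → E) : ℝ :=
  ∑ k ∈ Finset.range n, (c (ω k) (ω (k + 1)) : ℝ)

theorem block_sum (s0 : E) (c : E → E → ℝ≥0) (ω : ℕ → E)
    (hω : ∀ j, (Phi s0)^[j] ω ∈ ⋃ n, Ret s0 n) (J : ℕ) :
    ∑ i ∈ Finset.range J, (Wc s0 (fun x y => c x y) ((Phi s0)^[i] ω)).toReal
      = Af c (tj s0 ω J) ω := by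
  induction J with
  | zero => simp [tj, Af]
  | succ J ih =>
    rw [Finset.sum_range_succ, ih, phi_iter]
    have hJ := hω J
    rw [phi_iter] at hJ
    obtain ⟨n, hn⟩ := Set.mem_iUnion.1 hJ
    have : tj s0 ω (J + 1) = tj s0 ω J + n := by rw [tj, rt_of_ret hn]
    rw [this, Wc_of_ret _ hn, Af, Af, Finset.sum_range_add, ENNReal.toReal_sum (by simp)]
    rfl

theorem tj_strict (s0 : E) (ω : ℕ → E)
    (hω : ∀ j, (Phi s0)^[j] ω ∈ ⋃ n, Ret s0 n) : StrictMono (tj s0 ω) := by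
  refine strictMono_nat_of_lt_succ fun J => ?_
  have hJ := hω J
  rw [phi_iter] at hJ
  obtain ⟨n, hn⟩ := Set.mem_iUnion.1 hJ
  have : tj s0 ω (J + 1) = tj s0 ω J + n := by rw [tj, rt_of_ret hn]
  have h1 := hn.1
  omega

theorem ratio_sandwich (a b : ℕ → ℝ) (ha : Monotone a) (hb : Monotone b) (ha0 : ∀ n, 0 ≤ a n)
    (hb0 : ∀ n, 0 ≤ b n) (t : ℕ → ℕ) (ht : StrictMono t) (ht0 : t 0 = 0) (α β : ℝ) (hβ : 0 < β)
    (h1 : Tendsto (fun J : ℕ => a (t J) / J) atTop (nhds α))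
    (h2 : Tendsto (fun J : ℕ => b (t J) / J) atTop (nhds β)) :
    Tendsto b atTop atTop ∧ Tendsto (fun n => a n / b n) atTop (nhds (α / β)) := by
  set j : ℕ → ℕ := fun n => Nat.findGreatest (fun J => t J ≤ n) n with hj
  have hj1 : ∀ n, t (j n) ≤ n := fun n =>
    Nat.findGreatest_spec (P := fun J => t J ≤ n) (m := 0) (Nat.zero_le _) (by omega)
  have hj2 : ∀ n, n < t (j n + 1) := by
    intro n
    by_contra hcon
    push Not at hcon
    have h3 : j n + 1 ≤ n := (ht.le_apply).trans hcon
    have := Nat.le_findGreatest (P := fun J => t J ≤ n) h3 hcon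
    simp only [hj] at this
    omega
  have hjt : Tendsto j atTop atTop := by
    refine tendsto_atTop.2 fun J => ?_
    filter_upwards [eventually_ge_atTop (max J (t J))] with n hn
    exact Nat.le_findGreatest (P := fun J => t J ≤ n) (le_trans (le_max_left _ _) hn)
      (le_trans (le_max_right _ _) hn)
  have hs : Tendsto (fun J : ℕ => ((J + 1 : ℕ) : ℝ) / J) atTop (nhds 1) := by
    have h3 : Tendsto (fun J : ℕ => (1 : ℝ) + 1 / (J : ℝ)) atTop (nhds (1 + 0)) :=
      tendsto_const_nhds.add tendsto_one_div_atTop_nhds_zero_nat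
    rw [add_zero] at h3
    refine h3.congr' ?_
    filter_upwards [eventually_gt_atTop 0] with J hJ
    have : (J : ℝ) ≠ 0 := by positivity
    push_cast
    field_simp
  have hs' : ∀ (f : ℕ → ℝ) (x : ℝ), Tendsto (fun J : ℕ => f (t J) / J) atTop (nhds x) →
      Tendsto (fun J : ℕ => f (t (J + 1)) / J) atTop (nhds x) := by
    intro f x hf
    have h3 := (hf.comp (tendsto_add_atTop_nat 1)).mul hs
    rw [mul_one] at h3
    refine h3.congr' ?_
    filter_upwards [eventually_gt_atTop 0] with J hJ
    have : ((J + 1 : ℕ) : ℝ) ≠ 0 := by positivity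
    simp only [Function.comp]
    field_simp
  have hbT : Tendsto (fun J => b (t J)) atTop atTop := by
    have h3 : Tendsto (fun J : ℕ => b (t J) / J * J) atTop atTop :=
      h2.pos_mul_atTop hβ tendsto_natCast_atTop_atTop
    refine h3.congr' ?_
    filter_upwards [eventually_gt_atTop 0] with J hJ
    have : (J : ℝ) ≠ 0 := by positivity
    field_simp
  have hbjT : Tendsto (fun n => b (t (j n))) atTop atTop := hbT.comp hjt
  have hbT' : Tendsto b atTop atTop :=
    tendsto_atTop_mono (fun n => hb (hj1 n)) hbjT
  refine ⟨hbT', ?_⟩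
  have lo : Tendsto (fun J => a (t J) / b (t (J + 1))) atTop (nhds (α / β)) := by
    refine (h1.div (hs' b β h2) hβ.ne').congr' ?_
    filter_upwards [eventually_gt_atTop 0] with J hJ
    have : (J : ℝ) ≠ 0 := by positivity
    exact div_div_div_cancel_right₀ this _ _
  have hi : Tendsto (fun J => a (t (J + 1)) / b (t J)) atTop (nhds (α / β)) := by
    refine ((hs' a α h1).div h2 hβ.ne').congr' ?_
    filter_upwards [eventually_gt_atTop 0] with J hJ
    have : (J : ℝ) ≠ 0 := by positivity
    exact div_div_div_cancel_right₀ this _ _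
  refine tendsto_of_tendsto_of_tendsto_of_le_of_le' (lo.comp hjt) (hi.comp hjt) ?_ ?_
  · filter_upwards [hbT'.eventually_gt_atTop 0] with n hn
    simp only [Function.comp]
    have := hb (hj2 n).le
    have := ha (hj1 n)
    have := ha0 (t (j n))
    gcongr
    exact ha0 n
  · filter_upwards [hbjT.eventually_gt_atTop 0] with n hn
    simp only [Function.comp]
    have := hb (hj1 n)
    have := ha (hj2 n).le
    gcongr
    exact ha0 _

theorem Af_mono (c : E → E → ℝ≥0) (ω : ℕ → E) : Monotone (fun n => Af c n ω) := by
  refine monotone_nat_of_le_succ fun n => ?_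
  rw [Af, Af, Finset.sum_range_succ]
  simp

theorem Af_nonneg (c : E → E → ℝ≥0) (ω : ℕ → E) (n : ℕ) : 0 ≤ Af c n ω :=
  Finset.sum_nonneg fun _ _ => NNReal.coe_nonneg _

theorem meas_Af (c : E → E → ℝ≥0) (n : ℕ) : Measurable (Af c n) := by
  refine Finset.measurable_sum _ fun k _ => ?_
  exact (meas_pair c k (k + 1)).coe_nnreal_real

theorem Af_cns (c : E → E → ℝ≥0) (n : ℕ) (s : E) (ω : ℕ → E) :
    Af c (n + 1) (cns s ω) = Af c n ω + c s (ω 0) := by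
  rw [Af, Finset.sum_range_succ']
  rfl

/-- ratio limit theorem -/
theorem ratio_limit (h : MC K P) {s0 : E} {V g : E → ℝ≥0∞} (L : Lyap K s0 V g)
    (c e : E → E → ℝ≥0) (hc : ∫⁻ ω, Wc s0 (fun x y => c x y) ω ∂(P s0) ≠ ⊤)
    (he : ∫⁻ ω, Wc s0 (fun x y => e x y) ω ∂(P s0) ≠ ⊤)
    (he0 : ∫⁻ ω, Wc s0 (fun x y => e x y) ω ∂(P s0) ≠ 0) (s : E) :
    ∀ᵐ ω ∂(P s), Tendsto (fun n => Af e n ω) atTop atTop ∧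
      Tendsto (fun n => Af c n ω / Af e n ω) atTop
        (nhds ((∫⁻ ω, Wc s0 (fun x y => c x y) ω ∂(P s0)).toReal /
          (∫⁻ ω, Wc s0 (fun x y => e x y) ω ∂(P s0)).toReal)) := by
  have hp := h.prob
  set r := ((∫⁻ ω, Wc s0 (fun x y => c x y) ω ∂(P s0)).toReal /
          (∫⁻ ω, Wc s0 (fun x y => e x y) ω ∂(P s0)).toReal) with hr
  set G : Set (ℕ → E) := {ω | Tendsto (fun n => Af e n ω) atTop atTop} ∩
      {ω | Tendsto (fun n => Af c n ω / Af e n ω) atTop (nhds r)} with hG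
  have hGm : MeasurableSet G := by
    refine (measurableSet_tendsto _ fun n => meas_Af e n).inter ?_
    exact measurableSet_tendsto _ fun n => (meas_Af c n).div (meas_Af e n)
  have hmp := phi_mp h L
  have hG0 : P s0 Gᶜ = 0 := by
    show ∀ᵐ ω ∂(P s0), ω ∈ G
    have hall : ∀ᵐ ω ∂(P s0), ∀ j, (Phi s0)^[j] ω ∈ ⋃ n, Ret s0 n := by
      rw [ae_all_iff]
      intro j
      exact (hmp.iterate j).quasiMeasurePreserving.ae (ret_ae h L s0)
    filter_upwards [hall, block_slln h L _ hc, block_slln h L _ he] with ω h1 h2 h3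
    simp only [block_sum s0 _ ω h1] at h2 h3
    exact ratio_sandwich _ _ (Af_mono c ω) (Af_mono e ω) (Af_nonneg c ω) (Af_nonneg e ω)
      (tj s0 ω) (tj_strict s0 ω h1) rfl _ _ (ENNReal.toReal_pos he0 he) h2 h3
  have key := L.max_principle (fun s => P s Gᶜ) (fun s => prob_le_one) ?_ hG0 s
  · exact key
  · intro s
    rw [h.meas s hGm.compl]
    refine ENNReal.tsum_le_tsum fun y => mul_le_mul_right (measure_mono ?_) _
    intro ω hω hωG
    refine hω ?_
    obtain ⟨h1, h2⟩ := hωG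
    have h1' : Tendsto (fun n => Af e n ω) atTop atTop := h1
    have h2' : Tendsto (fun n => Af c n ω / Af e n ω) atTop (nhds r) := h2
    have h3 : Tendsto (fun n => Af e (n + 1) (cns s ω)) atTop atTop := by
      simp only [Af_cns]
      exact tendsto_atTop_add_const_right _ _ h1'
    refine ⟨(tendsto_add_atTop_iff_nat (f := fun n => Af e n (cns s ω)) 1).1 h3, ?_⟩
    refine (tendsto_add_atTop_iff_nat (f := fun n => Af c n (cns s ω) / Af e n (cns s ω)) 1).1 ?_
    simp only [Af_cns]
    have hz : ∀ x : ℝ, Tendsto (fun n => x / Af e n ω) atTop (nhds 0) := fun x =>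
      tendsto_const_nhds.div_atTop h1'
    have h4 : Tendsto (fun n => (Af c n ω / Af e n ω + (c s (ω 0) : ℝ) / Af e n ω) /
        (1 + (e s (ω 0) : ℝ) / Af e n ω)) atTop (nhds ((r + 0) / (1 + 0))) :=
      (h2'.add (hz _)).div (tendsto_const_nhds.add (hz _)) (by norm_num)
    have e0 : (r + 0) / (1 + 0) = r := by simp
    rw [e0] at h4
    refine h4.congr' ?_
    filter_upwards [h1'.eventually_gt_atTop 0] with n hn
    rw [← add_div]
    have : 1 + (e s (ω 0) : ℝ) / Af e n ω = (Af e n ω + e s (ω 0)) / Af e n ω := by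
      field_simp
    rw [this, div_div_div_cancel_right₀ hn.ne']

end Blocks

end PartC

section PartD
open scoped NNReal

section Exits

variable {m : ℕ}

/-- exit cost -/
noncomputable def Ec : ℤ × Fin m → ℤ × Fin m → ℝ≥0 := fun x _ => if x.1 ≤ 0 then 1 else 0

/-- the path has infinitely many exits -/
def InfE (ω : ℕ → ℤ × Fin m) : Prop := (Set.ofPred fun k => (ω k).1 ≤ 0).Infinite

theorem sigmaT_eq_nth {ω : ℕ → ℤ × Fin m} (h : InfE ω) (ι : ℕ) :
    sigmaT ι ω = Nat.nth (fun k => (ω k).1 ≤ 0) ι := by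
  induction ι with
  | zero => rw [Nat.nth_zero]; rfl
  | succ ι ih =>
    rw [Nat.nth_eq_sInf]
    show sInf {k : ℕ | sigmaT ι ω < k ∧ (ω k).1 ≤ 0} = _
    congr 1
    ext x
    simp only [Set.mem_ofPred_eq]
    rw [ih]
    constructor
    · rintro ⟨h1, h2⟩
      refine ⟨h2, fun k hk => lt_of_le_of_lt ?_ h1⟩
      exact (Nat.nth_strictMono h).monotone (by omega)
    · rintro ⟨h1, h2⟩
      exact ⟨h2 ι (by omega), h1⟩

theorem Af_Ec (ω : ℕ → ℤ × Fin m) (n : ℕ) :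
    Af Ec n ω = (Nat.count (fun k => (ω k).1 ≤ 0) n : ℝ) := by
  induction n with
  | zero => simp [Af]
  | succ n ih =>
    rw [Nat.count_succ, Af, Finset.sum_range_succ]
    change Af Ec n ω + _ = _
    rw [ih, Ec]
    split_ifs <;> simp

theorem Af_nth (c : ℤ × Fin m → ℤ × Fin m → ℝ≥0) (hc : ∀ x y, ¬ x.1 ≤ 0 → c x y = 0)
    (ω : ℕ → ℤ × Fin m) (n : ℕ) :
    Af c n ω = ∑ ι ∈ Finset.range (Nat.count (fun k => (ω k).1 ≤ 0) n),
      (c (ω (Nat.nth (fun k => (ω k).1 ≤ 0) ι)) (ω (Nat.nth (fun k => (ω k).1 ≤ 0) ι + 1)) : ℝ) := by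
  induction n with
  | zero => simp [Af]
  | succ n ih =>
    rw [Nat.count_succ, Af, Finset.sum_range_succ]
    change Af c n ω + _ = _
    rw [ih]
    split_ifs with hn
    · have : Nat.nth (fun k => (ω k).1 ≤ 0) (Nat.count (fun k => (ω k).1 ≤ 0) n) = n :=
        Nat.nth_count (p := fun k => (ω k).1 ≤ 0) hn
      rw [Finset.sum_range_succ, this]
    · rw [hc _ _ hn]; simp

theorem infE_of_tendsto {ω : ℕ → ℤ × Fin m} (h : Tendsto (fun n => Af Ec n ω) atTop atTop) :
    InfE ω := by
  intro hfin
  obtain ⟨n, hn⟩ := (h.eventually_gt_atTop (hfin.toFinset.card : ℝ)).exists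
  rw [Af_Ec] at hn
  have hn' : hfin.toFinset.card < Nat.count (fun k => (ω k).1 ≤ 0) n := by exact_mod_cast hn
  have : Nat.count (fun k => (ω k).1 ≤ 0) n ≤ hfin.toFinset.card := by
    rw [Nat.count_eq_card_filter_range]
    refine Finset.card_le_card ?_
    intro k hk
    simp only [Finset.mem_filter] at hk
    simpa using hk.2
  omega

variable {K : ℤ × Fin m → PMF (ℤ × Fin m)} {P : ℤ × Fin m → Measure (ℕ → ℤ × Fin m)}

theorem avg_limit (h : MC K P) {s0 : ℤ × Fin m} {V g : ℤ × Fin m → ℝ≥0∞} (L : Lyap K s0 V g)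
    (he : ∫⁻ ω, Wc s0 (fun x y => Ec x y) ω ∂(P s0) ≠ ⊤)
    (he0 : ∫⁻ ω, Wc s0 (fun x y => Ec x y) ω ∂(P s0) ≠ 0)
    (c : ℤ × Fin m → ℤ × Fin m → ℝ≥0) (hc0 : ∀ x y, ¬ x.1 ≤ 0 → c x y = 0)
    (hc : ∫⁻ ω, Wc s0 (fun x y => c x y) ω ∂(P s0) ≠ ⊤) (s : ℤ × Fin m) :
    ∀ᵐ ω ∂(P s), InfE ω ∧ Tendsto (fun N : ℕ => (∑ ι ∈ Finset.range N,
        (c (ω (sigmaT ι ω)) (ω (sigmaT ι ω + 1)) : ℝ)) / N) atTop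
        (nhds ((∫⁻ ω, Wc s0 (fun x y => c x y) ω ∂(P s0)).toReal /
          (∫⁻ ω, Wc s0 (fun x y => Ec x y) ω ∂(P s0)).toReal)) := by
  filter_upwards [ratio_limit h L c Ec hc he he0 s] with ω hω
  have hi := infE_of_tendsto hω.1
  refine ⟨hi, ?_⟩
  have ht : Tendsto (Nat.nth (fun k => (ω k).1 ≤ 0)) atTop atTop :=
    (Nat.nth_strictMono hi).tendsto_atTop
  refine (hω.2.comp ht).congr ?_
  intro N
  simp only [Function.comp, sigmaT_eq_nth hi]
  rw [Af_Ec, Af_nth c hc0, Nat.count_nth_of_infinite hi]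

theorem meas_sigmaT (ι : ℕ) : Measurable (sigmaT (m := m) ι) := by
  have hp : ∀ k, MeasurableSet {ω : ℕ → ℤ × Fin m | (ω k).1 ≤ 0} := fun k =>
    mset_coord k {s : ℤ × Fin m | s.1 ≤ 0}
  induction ι with
  | zero => exact meas_sInf (fun k (ω : ℕ → ℤ × Fin m) => (ω k).1 ≤ 0) hp
  | succ ι ih =>
    refine meas_sInf (fun k ω => sigmaT ι ω < k ∧ (ω k).1 ≤ 0) fun k => ?_
    exact (ih (measurableSet_Iio (a := k))).inter (hp k)

theorem sigmaT_shift {ω : ℕ → ℤ × Fin m} (h : InfE ω) {n : ℕ}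
    (hn : Nat.count (fun k => (ω k).1 ≤ 0) n = 1) (ι : ℕ) :
    InfE (shf n ω) ∧ sigmaT (ι + 1) ω = n + sigmaT ι (shf n ω) := by
  have hi : InfE (shf n ω) := by
    intro hfin
    refine h ?_
    have : (Set.ofPred fun k => (ω k).1 ≤ 0) ⊆ (Finset.range n : Set ℕ) ∪
        (fun k => n + k) '' (Set.ofPred fun k => (shf n ω k).1 ≤ 0) := by
      intro k hk
      by_cases hkn : k < n
      · left; simpa using hkn
      · right
        refine ⟨k - n, ?_, by simp only; omega⟩
        show (ω (n + (k - n))).1 ≤ 0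
        rw [Nat.add_sub_cancel' (by omega)]
        exact hk
    exact ((Finset.finite_toSet _).union (hfin.image _)).subset this
  refine ⟨hi, ?_⟩
  rw [sigmaT_eq_nth h, sigmaT_eq_nth hi]
  set b := Nat.nth (fun k => (shf n ω k).1 ≤ 0) ι with hb
  have h1 : (ω (n + b)).1 ≤ 0 := Nat.nth_mem_of_infinite (p := fun k => (shf n ω k).1 ≤ 0) hi ι
  have h2 : Nat.count (fun k => (ω k).1 ≤ 0) (n + b) = ι + 1 := by
    rw [Nat.count_add, hn, add_comm]
    congr 1
    exact Nat.count_nth_of_infinite (p := fun k => (shf n ω k).1 ≤ 0) hi ι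
  have h3 := Nat.nth_count (p := fun k => (ω k).1 ≤ 0) h1
  rw [h2] at h3
  exact h3

/-- decomposition of the law at the next exit/entrance -/
theorem law_step (h : MC K P) (hinf : ∀ s, ∀ᵐ ω ∂(P s), InfE ω)
    (T : (ℕ → ℤ × Fin m) → ℕ) (T' : (ℕ → ℤ × Fin m) → ℕ) (Q : ℕ → Set (ℕ → ℤ × Fin m))
    (hQm : ∀ n, MeasurableSet (Q n)) (hQd : ∀ n, Dep n (Q n))
    (hQc : ∀ n, ∀ ω ∈ Q n, Nat.count (fun k => (ω k).1 ≤ 0) n = 1)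
    (hQT : ∀ n, ∀ ω ∈ Q n, T' ω = n)
    (hT : ∀ ω, InfE ω → T ω = T' ω ∧ ω ∈ Q (T' ω)) (d ι : ℕ) (s u : ℤ × Fin m) :
    P s {ω | ω (sigmaT (ι + 1) ω + d) = u} =
      ∑' y, P s {ω | ω (T ω) ∈ ({y} : Set (ℤ × Fin m))} * P y {ω | ω (sigmaT ι ω + d) = u} := by
  set B : Set (ℕ → ℤ × Fin m) := {ω | ω (sigmaT ι ω + d) = u} with hB
  have hBm : MeasurableSet B := by
    have : Measurable (fun ω : ℕ → ℤ × Fin m => ω (sigmaT ι ω + d)) := meas_at ((meas_sigmaT ι).add_const d)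
    exact this (MeasurableSet.of_discrete (s := {u}))
  have hQdis : ∀ i j, i ≠ j → Disjoint (Q i) (Q j) := by
    intro i j hij
    refine Set.disjoint_left.2 fun ω hi hj => hij ?_
    rw [← hQT i ω hi, ← hQT j ω hj]
  have key : ∀ y, P s {ω | ω (T ω) ∈ ({y} : Set (ℤ × Fin m))} * P y B =
      P s (⋃ n, (Q n ∩ {ω | ω n ∈ ({y} : Set (ℤ × Fin m))}) ∩ shf n ⁻¹' B) := by
    intro y
    rw [h.strong y hBm (fun n => Q n ∩ {ω | ω n ∈ ({y} : Set (ℤ × Fin m))})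
      (fun n => (hQm n).inter (mset_coord n _)) ?_ ?_ ?_ s]
    · congr 1
      refine measure_congr ?_
      filter_upwards [hinf s] with ω hω
      obtain ⟨h1, h2⟩ := hT ω hω
      refine propext ⟨fun hh => ?_, fun hh => ?_⟩
      · have hh' : ω (T ω) = y := hh
        refine Set.mem_iUnion.2 ⟨T' ω, h2, ?_⟩
        rw [← h1]
        exact hh'
      · obtain ⟨n, hn1, hn2⟩ := Set.mem_iUnion.1 hh
        show ω (T ω) = y
        rw [h1, hQT n ω hn1]
        exact hn2
    · rintro n ω ω' hh ⟨h1, h2⟩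
      refine ⟨hQd n ω ω' hh h1, ?_⟩
      show ω' n = y
      rw [← hh n le_rfl]
      exact h2
    · rintro n ω ⟨_, h2⟩
      exact h2
    · intro i j hij
      exact (hQdis i j hij).mono Set.inter_subset_left Set.inter_subset_left
  simp_rw [key]
  rw [← measure_iUnion]
  · refine measure_congr ?_
    filter_upwards [hinf s] with ω hω
    obtain ⟨h1, h2⟩ := hT ω hω
    have hs := sigmaT_shift hω (hQc _ ω h2) ι
    have hval : ω (sigmaT (ι + 1) ω + d) = shf (T' ω) ω (sigmaT ι (shf (T' ω) ω) + d) := by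
      rw [hs.2, shf, add_assoc]
    refine propext ⟨fun hh => ?_, fun hh => ?_⟩
    · have hh' : ω (sigmaT (ι + 1) ω + d) = u := hh
      refine Set.mem_iUnion.2 ⟨ω (T' ω), Set.mem_iUnion.2 ⟨T' ω, ⟨h2, rfl⟩, ?_⟩⟩
      show shf (T' ω) ω (sigmaT ι (shf (T' ω) ω) + d) = u
      rw [← hval]; exact hh'
    · obtain ⟨y, hy⟩ := Set.mem_iUnion.1 hh
      obtain ⟨n, ⟨hn1, hn2⟩, hn3⟩ := Set.mem_iUnion.1 hy
      have := hQT n ω hn1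
      subst this
      show ω (sigmaT (ι + 1) ω + d) = u
      rw [hval]
      exact hn3
  · intro y y' hyy
    refine Set.disjoint_left.2 fun ω hω hω' => hyy ?_
    obtain ⟨n, ⟨hn1, hn2⟩, hn3⟩ := Set.mem_iUnion.1 hω
    obtain ⟨n', ⟨hn1', hn2'⟩, hn3'⟩ := Set.mem_iUnion.1 hω'
    have e : n = n' := by rw [← hQT n ω hn1, ← hQT n' ω hn1']
    subst e
    have a1 : ω n = y := hn2
    have a2 : ω n = y' := hn2'
    rw [← a1, ← a2]
  · intro y
    exact MeasurableSet.iUnion fun n => ((hQm n).inter (mset_coord n _)).inter (measurable_shf n hBm)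

theorem stat_law {T : (ℕ → ℤ × Fin m) → ℕ} {d : ℕ} {π : Measure (ℤ × Fin m)}
    (hstep : ∀ ι s u, P s {ω | ω (sigmaT (ι + 1) ω + d) = u} =
      ∑' y, P s {ω | ω (T ω) ∈ ({y} : Set (ℤ × Fin m))} * P y {ω | ω (sigmaT ι ω + d) = u})
    (hstat : ∀ A : Set (ℤ × Fin m), ∑' s, π {s} * P s {ω | ω (T ω) ∈ A} = π A)
    (hbase : ∀ u, ∑' s, π {s} * P s {ω | ω (sigmaT 0 ω + d) = u} = π {u}) (ι : ℕ) :
    ∀ u, ∑' s, π {s} * P s {ω | ω (sigmaT ι ω + d) = u} = π {u} := by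
  induction ι with
  | zero => exact hbase
  | succ ι ih =>
    intro u
    rw [← ih u]
    simp_rw [hstep]
    calc _ = ∑' s, ∑' y, π {s} * (P s {ω | ω (T ω) ∈ ({y} : Set (ℤ × Fin m))} *
            P y {ω | ω (sigmaT ι ω + d) = u}) := by
          simp_rw [ENNReal.tsum_mul_left]
      _ = ∑' y, ∑' s, π {s} * (P s {ω | ω (T ω) ∈ ({y} : Set (ℤ × Fin m))} *
            P y {ω | ω (sigmaT ι ω + d) = u}) := ENNReal.tsum_comm
      _ = _ := by
          refine tsum_congr fun y => ?_
          rw [← hstat {y}, ← ENNReal.tsum_mul_right]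
          refine tsum_congr fun s => ?_
          rw [mul_assoc]

theorem ident (hp : ∀ s, IsProbabilityMeasure (P s)) {d : ℕ} {π : Measure (ℤ × Fin m)}
    [IsProbabilityMeasure π] (u : ℤ × Fin m) (r : ℝ)
    (hlaw : ∀ ι, ∑' s, π {s} * P s {ω | ω (sigmaT ι ω + d) = u} = π {u})
    (hlim : ∀ s, ∀ᵐ ω ∂(P s), Tendsto (fun N : ℕ => (∑ ι ∈ Finset.range N,
        (if ω (sigmaT ι ω + d) = u then (1 : ℝ) else 0)) / N) atTop (nhds r)) :
    r = (π {u}).toReal := by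
  set M : Measure (ℕ → ℤ × Fin m) := Measure.sum (fun s => π {s} • P s) with hM
  have hMprob : IsProbabilityMeasure M := by
    constructor
    rw [hM, Measure.sum_apply _ MeasurableSet.univ]
    simp only [Measure.smul_apply, measure_univ, smul_eq_mul, mul_one]
    have : ∑' s, π {s} = π Set.univ := by
      rw [← Set.iUnion_of_singleton, measure_iUnion]
      · intro i j hij
        simpa using hij
      · intro i; exact measurableSet_singleton i
    rw [this, measure_univ]
  have hset : ∀ ι, MeasurableSet {ω : ℕ → ℤ × Fin m | ω (sigmaT ι ω + d) = u} := by
    intro ι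
    have : Measurable (fun ω : ℕ → ℤ × Fin m => ω (sigmaT ι ω + d)) := meas_at ((meas_sigmaT ι).add_const d)
    exact this (MeasurableSet.of_discrete (s := {u}))
  have hfm : ∀ ι, Measurable (fun ω : ℕ → ℤ × Fin m => if ω (sigmaT ι ω + d) = u then (1 : ℝ) else 0) :=
    fun ι => Measurable.ite (hset ι) measurable_const measurable_const
  have hfi : ∀ ι, ∫ ω, (if ω (sigmaT ι ω + d) = u then (1 : ℝ) else 0) ∂M = (π {u}).toReal := by
    intro ι
    have e : (fun ω : ℕ → ℤ × Fin m => if ω (sigmaT ι ω + d) = u then (1 : ℝ) else 0) =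
        Set.indicator {ω | ω (sigmaT ι ω + d) = u} 1 := by
      funext ω
      simp [Set.indicator]
    rw [e, integral_indicator_one (hset ι), measureReal_def, hM, Measure.sum_apply _ (hset ι)]
    rw [← hlaw ι]
    rfl
  have hb : ∀ ι ω, ‖(if (ω : ℕ → ℤ × Fin m) (sigmaT ι ω + d) = u then (1 : ℝ) else 0)‖ ≤ 1 := by
    intro ι ω
    split_ifs <;> simp
  have hconv := tendsto_integral_of_dominated_convergence (μ := M)
    (F := fun (N : ℕ) ω => (∑ ι ∈ Finset.range N,
        (if (ω : ℕ → ℤ × Fin m) (sigmaT ι ω + d) = u then (1 : ℝ) else 0)) / N)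
    (f := fun _ => r) (fun _ => (1 : ℝ)) ?_ (integrable_const _) ?_ ?_
  · have hc : (∫ _, r ∂M) = r := by simp
    rw [hc] at hconv
    refine tendsto_nhds_unique hconv ?_
    refine tendsto_const_nhds.congr' ?_
    filter_upwards [eventually_gt_atTop 0] with N hN
    rw [integral_div, integral_finsetSum]
    · simp_rw [hfi]
      have : (N : ℝ) ≠ 0 := by positivity
      simp [this]
    · intro ι _
      exact Integrable.of_bound (hfm ι).aestronglyMeasurable 1 (ae_of_all _ (hb ι))
  · intro N
    exact ((Finset.measurable_sum _ fun ι _ => hfm ι).div_const _).aestronglyMeasurable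
  · intro N
    refine ae_of_all _ fun ω => ?_
    rw [norm_div]
    by_cases hN : N = 0
    · simp [hN]
    · have hN' : (0 : ℝ) < N := by positivity
      rw [div_le_one (by simpa using hN')]
      refine (norm_sum_le _ _).trans ?_
      refine (Finset.sum_le_sum fun ι _ => hb ι ω).trans ?_
      simp
  · rw [hM, Measure.ae_sum_iff]
    intro s
    exact Measure.ae_smul_measure (hlim s) _

end Exits

end PartD

section PartE
open scoped NNReal

section Laws

variable {m : ℕ}
variable {K : ℤ × Fin m → PMF (ℤ × Fin m)} {P : ℤ × Fin m → Measure (ℕ → ℤ × Fin m)}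

theorem meas_count (n : ℕ) :
    Measurable (fun ω : ℕ → ℤ × Fin m => Nat.count (fun k => (ω k).1 ≤ 0) n) := by
  induction n with
  | zero => simp
  | succ n ih =>
    simp_rw [Nat.count_succ]
    exact ih.add (Measurable.ite (mset_coord n {s : ℤ × Fin m | s.1 ≤ 0})
      measurable_const measurable_const)

theorem count_congr_path {ω ω' : ℕ → ℤ × Fin m} (n : ℕ) (h : ∀ k ≤ n, ω k = ω' k) :
    Nat.count (fun k => (ω k).1 ≤ 0) n = Nat.count (fun k => (ω' k).1 ≤ 0) n := by
  induction n with
  | zero => simp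
  | succ n ih =>
    rw [Nat.count_succ, Nat.count_succ, ih (fun k hk => h k (by omega)), h n (by omega)]

theorem exit_law (h : MC K P) (hinf : ∀ s, ∀ᵐ ω ∂(P s), InfE ω)
    {π : Measure (ℤ × Fin m)} (hπ : ExitStationary P π) (ι : ℕ) (u : ℤ × Fin m) :
    ∑' s, π {s} * P s {ω | ω (sigmaT ι ω + 0) = u} = π {u} := by
  refine stat_law (T := sigmaT 1) (d := 0) (fun ι s u => ?_) hπ.2.2 (fun u => ?_) ι u
  · refine law_step h hinf (sigmaT 1) (fun ω => Nat.nth (fun k => (ω k).1 ≤ 0) 1)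
      (fun n => {ω | Nat.count (fun k => (ω k).1 ≤ 0) n = 1} ∩ {ω | ω n ∈ {s : ℤ × Fin m | s.1 ≤ 0}})
      ?_ ?_ ?_ ?_ ?_ 0 ι s u
    · intro n
      exact (meas_count n (measurableSet_singleton 1)).inter (mset_coord n _)
    · rintro n ω ω' hh ⟨h1, h2⟩
      refine ⟨?_, ?_⟩
      · show Nat.count _ n = 1
        rw [← count_congr_path n hh]; exact h1
      · show ω' n ∈ {s : ℤ × Fin m | s.1 ≤ 0}
        rw [← hh n le_rfl]; exact h2
    · rintro n ω ⟨h1, h2⟩; exact h1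
    · rintro n ω ⟨h1, h2⟩
      have h3 := Nat.nth_count (p := fun k => (ω k).1 ≤ 0) (n := n) h2
      have h1' : Nat.count (fun k => (ω k).1 ≤ 0) n = 1 := h1
      rw [h1'] at h3
      exact h3
    · intro ω hω
      refine ⟨sigmaT_eq_nth hω 1, ?_, ?_⟩
      · exact Nat.count_nth_of_infinite (p := fun k => (ω k).1 ≤ 0) hω 1
      · exact Nat.nth_mem_of_infinite (p := fun k => (ω k).1 ≤ 0) hω 1
  · rw [tsum_eq_single u]
    · by_cases hu : u.1 ≤ 0
      · have : P u {ω | ω (sigmaT 0 ω + 0) = u} = 1 := by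
          have := h.prob u
          rw [← prob_compl_eq_zero_iff]
          · refine measure_mono_null ?_ (h.start u)
            intro ω hω hω'
            apply hω
            have e : ω 0 = u := hω'
            have : sigmaT 0 ω = 0 := by
              show sInf {k : ℕ | (ω k).1 ≤ 0} = 0
              rw [Nat.sInf_eq_zero]; left
              show (ω 0).1 ≤ 0
              rw [e]; exact hu
            show ω (sigmaT 0 ω + 0) = u
            rw [this]; exact e
          · have : Measurable (fun ω : ℕ → ℤ × Fin m => ω (sigmaT 0 ω + 0)) :=
              meas_at ((meas_sigmaT 0).add_const 0)
            exact this (MeasurableSet.of_discrete (s := {u}))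
        rw [this, mul_one]
      · have : π {u} = 0 := by
          refine measure_mono_null ?_ hπ.2.1
          intro s hs
          have : s = u := hs
          rw [this]
          show 1 ≤ u.1
          omega
        simp [this]
    · intro s hs
      by_cases hu : s.1 ≤ 0
      · have : P s {ω | ω (sigmaT 0 ω + 0) = u} = 0 := by
          refine measure_mono_null ?_ (h.start s)
          intro ω hω hω'
          apply hs
          have e : ω 0 = s := hω'
          have : sigmaT 0 ω = 0 := by
            show sInf {k : ℕ | (ω k).1 ≤ 0} = 0
            rw [Nat.sInf_eq_zero]; left
            show (ω 0).1 ≤ 0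
            rw [e]; exact hu
          have hω2 : ω (sigmaT 0 ω + 0) = u := hω
          rw [this] at hω2
          rw [← e]; exact hω2
        rw [this, mul_zero]
      · have : π {s} = 0 := by
          refine measure_mono_null ?_ hπ.2.1
          intro s' hs'
          have : s' = s := hs'
          rw [this]
          show 1 ≤ s.1
          omega
        simp [this]

theorem ent_law (h : MC K P) (hinf : ∀ s, ∀ᵐ ω ∂(P s), InfE ω)
    {π : Measure (ℤ × Fin m)} (hπ : EntranceStationary P π) (ι : ℕ) (u : ℤ × Fin m) :
    ∑' s, π {s} * P s {ω | ω (sigmaT ι ω + 1) = u} = π {u} := by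
  refine stat_law (T := fun ω => sigmaT 0 ω + 1) (d := 1) (fun ι s u => ?_) hπ.2.2
    (fun u => hπ.2.2 {u}) ι u
  refine law_step h hinf (fun ω => sigmaT 0 ω + 1) (fun ω => Nat.nth (fun k => (ω k).1 ≤ 0) 0 + 1)
      (fun n => {ω | Nat.count (fun k => (ω k).1 ≤ 0) n = 1} ∩
        {ω | ω (n - 1) ∈ {s : ℤ × Fin m | s.1 ≤ 0}})
      ?_ ?_ ?_ ?_ ?_ 1 ι s u
  · intro n
    exact (meas_count n (measurableSet_singleton 1)).inter (mset_coord (n - 1) _)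
  · rintro n ω ω' hh ⟨h1, h2⟩
    refine ⟨?_, ?_⟩
    · show Nat.count _ n = 1
      rw [← count_congr_path n hh]; exact h1
    · show ω' (n - 1) ∈ {s : ℤ × Fin m | s.1 ≤ 0}
      rw [← hh (n - 1) (by omega)]; exact h2
  · rintro n ω ⟨h1, h2⟩; exact h1
  · rintro n ω ⟨h1, h2⟩
    have h1' : Nat.count (fun k => (ω k).1 ≤ 0) n = 1 := h1
    have hp : (ω (n - 1)).1 ≤ 0 := h2
    cases n with
    | zero => simp at h1'
    | succ n =>
      simp only [Nat.add_sub_cancel] at hp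
      rw [Nat.count_succ, if_pos hp] at h1'
      have h3 := Nat.nth_count (p := fun k => (ω k).1 ≤ 0) (n := n) hp
      have h4 : Nat.count (fun k => (ω k).1 ≤ 0) n = 0 := by omega
      rw [h4] at h3
      show Nat.nth (fun k => (ω k).1 ≤ 0) 0 + 1 = n + 1
      rw [h3]
  · intro ω hω
    have hp : (ω (Nat.nth (fun k => (ω k).1 ≤ 0) 0)).1 ≤ 0 :=
      Nat.nth_mem_of_infinite (p := fun k => (ω k).1 ≤ 0) hω 0
    refine ⟨by rw [sigmaT_eq_nth hω 0], ?_, ?_⟩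
    · show Nat.count _ (_ + 1) = 1
      rw [Nat.count_succ, if_pos hp, Nat.count_nth_of_infinite (p := fun k => (ω k).1 ≤ 0) hω 0]
    · exact hp

/-- the cost attached to a weight read off at the exit or at the entrance -/
noncomputable def Cw (sel : ℤ × Fin m → ℤ × Fin m → ℤ × Fin m) (w : ℤ × Fin m → ℝ≥0) :
    ℤ × Fin m → ℤ × Fin m → ℝ≥0 := fun x y => if x.1 ≤ 0 then w (sel x y) else 0

theorem Wc_tonelli (s0 : ℤ × Fin m) (sel : ℤ × Fin m → ℤ × Fin m → ℤ × Fin m)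
    (w : ℤ × Fin m → ℝ≥0) (Q : Measure (ℕ → ℤ × Fin m)) :
    ∫⁻ ω, Wc s0 (fun x y => Cw sel w x y) ω ∂Q =
      ∑' u, (w u : ℝ≥0∞) * ∫⁻ ω, Wc s0 (fun x y => Cw sel (fun z => if z = u then 1 else 0) x y) ω ∂Q := by
  have hpt : ∀ ω, Wc s0 (fun x y => Cw sel w x y) ω =
      ∑' u, (w u : ℝ≥0∞) * Wc s0 (fun x y => Cw sel (fun z => if z = u then 1 else 0) x y) ω := by
    intro ω
    unfold Wc
    simp_rw [← ENNReal.tsum_mul_left]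
    rw [ENNReal.tsum_comm]
    refine tsum_congr fun k => ?_
    by_cases hk : ∀ j, 1 ≤ j → j ≤ k → ω j ≠ s0
    · simp only [if_pos hk, Cw]
      by_cases hx : (ω k).1 ≤ 0
      · simp only [if_pos hx]
        rw [tsum_eq_single (sel (ω k) (ω (k + 1)))]
        · simp
        · intro u hu
          simp [Ne.symm hu]
      · simp [hx]
    · simp [hk]
  simp_rw [hpt]
  rw [lintegral_tsum]
  · refine tsum_congr fun u => ?_
    rw [lintegral_const_mul _ (meas_Wc s0 _)]
  · intro u
    exact ((meas_Wc s0 _).const_mul _).aemeasurable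

theorem Wc_mono {s0 : ℤ × Fin m} {c c' : ℤ × Fin m → ℤ × Fin m → ℝ≥0∞} (hc : ∀ x y, c x y ≤ c' x y)
    (ω : ℕ → ℤ × Fin m) : Wc s0 c ω ≤ Wc s0 c' ω := by
  unfold Wc
  refine ENNReal.tsum_le_tsum fun k => ?_
  split_ifs
  · exact hc _ _
  · exact le_rfl

theorem weight_limit (h : MC K P) {s0 : ℤ × Fin m} {V g : ℤ × Fin m → ℝ≥0∞} (L : Lyap K s0 V g)
    (he : ∫⁻ ω, Wc s0 (fun x y => Ec x y) ω ∂(P s0) ≠ ⊤)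
    (he0 : ∫⁻ ω, Wc s0 (fun x y => Ec x y) ω ∂(P s0) ≠ 0)
    (sel : ℤ × Fin m → ℤ × Fin m → ℤ × Fin m) (d : ℕ)
    (hsel : ∀ (ω : ℕ → ℤ × Fin m) k, sel (ω k) (ω (k + 1)) = ω (k + d))
    {π : Measure (ℤ × Fin m)} [IsProbabilityMeasure π]
    (hlaw : ∀ ι u, ∑' s, π {s} * P s {ω | ω (sigmaT ι ω + d) = u} = π {u})
    (w : ℤ × Fin m → ℝ≥0) (hw : ∫⁻ ω, Wc s0 (fun x y => Cw sel w x y) ω ∂(P s0) ≠ ⊤) :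
    Summable (fun u => (w u : ℝ) * (π {u}).toReal) ∧
    ∀ s, ∀ᵐ ω ∂(P s), Tendsto (fun N : ℕ => (∑ ι ∈ Finset.range N,
        (w (ω (sigmaT ι ω + d)) : ℝ)) / N) atTop
        (nhds (∑' u, (w u : ℝ) * (π {u}).toReal)) := by
  have hgen : ∀ (w : ℤ × Fin m → ℝ≥0) (hw : ∫⁻ ω, Wc s0 (fun x y => Cw sel w x y) ω ∂(P s0) ≠ ⊤),
     ∀ s, ∀ᵐ ω ∂(P s), Tendsto (fun N : ℕ => (∑ ι ∈ Finset.range N,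
        (w (ω (sigmaT ι ω + d)) : ℝ)) / N) atTop
        (nhds ((∫⁻ ω, Wc s0 (fun x y => Cw sel w x y) ω ∂(P s0)).toReal /
          (∫⁻ ω, Wc s0 (fun x y => Ec x y) ω ∂(P s0)).toReal)) := by
    intro w hw s
    filter_upwards [avg_limit h L he he0 (Cw sel w) (fun x y hx => by simp [Cw, hx]) hw s] with ω hω
    refine hω.2.congr fun N => ?_
    congr 1
    refine Finset.sum_congr rfl fun ι _ => ?_
    have hx : (ω (sigmaT ι ω)).1 ≤ 0 := by
      rw [sigmaT_eq_nth hω.1]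
      exact Nat.nth_mem_of_infinite (p := fun k => (ω k).1 ≤ 0) hω.1 ι
    rw [Cw, if_pos hx, hsel]
  have hufin : ∀ u, ∫⁻ ω, Wc s0 (fun x y => Cw sel (fun z => if z = u then 1 else 0) x y) ω ∂(P s0) ≠ ⊤ := by
    intro u
    refine ne_top_of_le_ne_top he (lintegral_mono fun ω => Wc_mono (fun x y => ?_) ω)
    rw [ENNReal.coe_le_coe, Cw, Ec]
    split_ifs <;> simp
  have hu : ∀ u, (∫⁻ ω, Wc s0 (fun x y => Cw sel (fun z => if z = u then 1 else 0) x y) ω ∂(P s0)).toReal /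
          (∫⁻ ω, Wc s0 (fun x y => Ec x y) ω ∂(P s0)).toReal = (π {u}).toReal := by
    intro u
    refine ident h.prob (d := d) u _ (fun ι => hlaw ι u) fun s => ?_
    filter_upwards [hgen _ (hufin u) s] with ω hω
    refine hω.congr fun N => ?_
    congr 1
    refine Finset.sum_congr rfl fun ι _ => ?_
    split_ifs <;> simp
  have hton := Wc_tonelli s0 sel w (P s0)
  have hterm : ∀ u, ((w u : ℝ≥0∞) * ∫⁻ ω, Wc s0 (fun x y => Cw sel (fun z => if z = u then 1 else 0) x y) ω ∂(P s0)).toReal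
      / (∫⁻ ω, Wc s0 (fun x y => Ec x y) ω ∂(P s0)).toReal = (w u : ℝ) * (π {u}).toReal := by
    intro u
    rw [ENNReal.toReal_mul, ← hu u, mul_div_assoc]
    rfl
  refine ⟨?_, ?_⟩
  · have := (ENNReal.summable_toReal (hton ▸ hw)).div_const
      (∫⁻ ω, Wc s0 (fun x y => Ec x y) ω ∂(P s0)).toReal
    exact this.congr hterm
  · have e : (∫⁻ ω, Wc s0 (fun x y => Cw sel w x y) ω ∂(P s0)).toReal /
          (∫⁻ ω, Wc s0 (fun x y => Ec x y) ω ∂(P s0)).toReal = ∑' u, (w u : ℝ) * (π {u}).toReal := by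
      rw [hton, ENNReal.tsum_toReal_eq, ← tsum_div_const]
      · exact tsum_congr hterm
      · intro u
        exact ENNReal.mul_ne_top ENNReal.coe_ne_top (hufin u)
    rw [← e]
    exact hgen w hw

end Laws

end PartE

section PartF
open scoped NNReal

section Final

variable {m : ℕ}
variable {K : ℤ × Fin m → PMF (ℤ × Fin m)} {P : ℤ × Fin m → Measure (ℕ → ℤ × Fin m)}

theorem enter_ae (h : MC K P)
    (hA2 : ∀ x : ℤ, x ≤ 0 → ∀ i : Fin m, ∀ s' : ℤ × Fin m, K (x, i) s' ≠ 0 → 1 ≤ s'.1)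
    (s : ℤ × Fin m) : ∀ᵐ ω ∂(P s), ∀ k, (ω k).1 ≤ 0 → 1 ≤ (ω (k + 1)).1 := by
  rw [ae_all_iff]
  intro k
  have hm : ∀ k, MeasurableSet {ω : ℕ → ℤ × Fin m | ¬ ((ω k).1 ≤ 0 → 1 ≤ (ω (k + 1)).1)} := by
    intro k
    have : {ω : ℕ → ℤ × Fin m | ¬ ((ω k).1 ≤ 0 → 1 ≤ (ω (k + 1)).1)} =
      {ω | ω k ∈ {s : ℤ × Fin m | s.1 ≤ 0}} ∩ {ω | ω (k + 1) ∈ {s : ℤ × Fin m | ¬ 1 ≤ s.1}} := by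
      ext ω; simp
    rw [this]
    exact (mset_coord k _).inter (mset_coord (k + 1) _)
  have : ∀ s, P s {ω : ℕ → ℤ × Fin m | ¬ ((ω k).1 ≤ 0 → 1 ≤ (ω (k + 1)).1)} = 0 := by
    induction k with
    | zero =>
      intro s
      rw [h.meas s (hm 0), ENNReal.tsum_eq_zero]
      intro y
      by_cases hs : s.1 ≤ 0
      · by_cases hK : K s y = 0
        · rw [hK, zero_mul]
        · have hy := hA2 s.1 hs s.2 y hK
          have : P y (cns s ⁻¹' {ω : ℕ → ℤ × Fin m | ¬ ((ω 0).1 ≤ 0 → 1 ≤ (ω (0 + 1)).1)}) = 0 := by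
            refine measure_mono_null ?_ (h.start y)
            intro ω hω hω'
            have e : ω 0 = y := hω'
            apply hω
            intro _
            show 1 ≤ (ω 0).1
            rw [e]; exact hy
          rw [this, mul_zero]
      · have : cns s ⁻¹' {ω : ℕ → ℤ × Fin m | ¬ ((ω 0).1 ≤ 0 → 1 ≤ (ω (0 + 1)).1)} = ∅ := by
          refine Set.eq_empty_of_forall_notMem fun ω hω => hω fun h0 => absurd h0 ?_
          exact hs
        rw [this, measure_empty, mul_zero]
    | succ k ih =>
      intro s
      rw [h.meas s (hm (k + 1)), ENNReal.tsum_eq_zero]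
      intro y
      have := ih y
      have e : cns s ⁻¹' {ω : ℕ → ℤ × Fin m | ¬ ((ω (k + 1)).1 ≤ 0 → 1 ≤ (ω (k + 1 + 1)).1)} =
        {ω : ℕ → ℤ × Fin m | ¬ ((ω k).1 ≤ 0 → 1 ≤ (ω (k + 1)).1)} := rfl
      rw [e, this, mul_zero]
  exact this s

theorem exit_pos (h : MC K P) {s0 y : ℤ × Fin m} (hs0 : 1 ≤ s0.1) (hy : y.1 ≤ 0) (hK : K s0 y ≠ 0) :
    ∫⁻ ω, Wc s0 (fun x y => Ec x y) ω ∂(P s0) ≠ 0 := by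
  have hne : y ≠ s0 := by rintro rfl; omega
  set path : ℕ → ℤ × Fin m := fun k => if k = 0 then s0 else y with hpath
  have hc := h.cyl1 1 path
  have h0 : path 0 = s0 := by simp [hpath]
  have h1 : path 1 = y := by simp [hpath]
  have hmeas : MeasurableSet {ω : ℕ → ℤ × Fin m | ∀ k ≤ 1, ω k = path k} := measurableSet_cyl 1 path
  rw [Finset.prod_range_one, h0] at hc
  have hge : P s0 {ω : ℕ → ℤ × Fin m | ∀ k ≤ 1, ω k = path k} ≤
      ∫⁻ ω, Wc s0 (fun x y => Ec x y) ω ∂(P s0) := by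
    rw [← lintegral_indicator_one hmeas]
    refine lintegral_mono fun ω => ?_
    refine Set.indicator_le (fun ω hω => ?_) ω
    have hω1 : ω 1 = y := by rw [← h1]; exact hω 1 le_rfl
    unfold Wc
    refine le_trans ?_ (ENNReal.le_tsum 1)
    rw [if_pos]
    · simp [Ec, hω1, hy]
    · intro j hj hj'
      have : j = 1 := by omega
      rw [this, hω1]; exact hne
  intro hz
  rw [hz, hc] at hge
  simp only [zero_add, h1] at hge
  exact hK (le_antisymm hge bot_le)

theorem final_of_lyap (h : MC K P) (v : Fin m → ℝ) (hv : ∀ i, 0 < v i)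
    (hA2 : ∀ x : ℤ, x ≤ 0 → ∀ i : Fin m, ∀ s' : ℤ × Fin m, K (x, i) s' ≠ 0 → 1 ≤ s'.1)
    (C : ℝ) (hC : 0 < C)
    (hA3 : ∀ x : ℤ, x ≤ 0 → ∀ i : Fin m,
      ∑' s' : ℤ × Fin m, (s'.1.toNat : ℝ≥0∞) * K (x, i) s' ≤
        ENNReal.ofReal (C * (1 + |(x : ℝ)|)))
    {s0 : ℤ × Fin m} {V g : ℤ × Fin m → ℝ≥0∞} (L : Lyap K s0 V g)
    (hge : ∀ s, s.1 ≤ 0 → ((1 + s.1.natAbs : ℕ) : ℝ≥0∞) ≤ g s)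
    (he0 : ∫⁻ ω, Wc s0 (fun x y => Ec x y) ω ∂(P s0) ≠ 0)
    (πexit πent : Measure (ℤ × Fin m))
    (hπexit : ExitStationary P πexit) (hπent : EntranceStationary P πent)
    (μ : ℝ)
    (hμ : μ = (∑' s : ℤ × Fin m, ((s.1 : ℝ) / v s.2) * (πent {s}).toReal) -
      (∑' s : ℤ × Fin m, ((s.1 : ℝ) / v s.2) * (πexit {s}).toReal)) :
    0 < μ ∧
    ∀ s₀ : ℤ × Fin m, ∀ᵐ ω ∂(P s₀),
      Tendsto (fun N : ℕ => (1 / (N : ℝ)) *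
          ∑ ι ∈ Finset.range N,
            (((ω (sigmaT ι ω + 1)).1 : ℝ) / v (ω (sigmaT ι ω + 1)).2 -
              ((ω (sigmaT ι ω)).1 : ℝ) / v (ω (sigmaT ι ω)).2))
        atTop (nhds μ) := by
  have hpe := hπexit.1
  have hpn := hπent.1
  obtain ⟨a, ha⟩ : ∃ a : ℝ≥0, ∀ i, ((v i).toNNReal)⁻¹ ≤ a :=
    ⟨∑ i, ((v i).toNNReal)⁻¹, fun i => Finset.single_le_sum (f := fun i => ((v i).toNNReal)⁻¹)
      (fun _ _ => zero_le) (Finset.mem_univ i)⟩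
  set wx : ℤ × Fin m → ℝ≥0 := fun s => (s.1.natAbs : ℝ≥0) * ((v s.2).toNNReal)⁻¹ with hwx
  set wn : ℤ × Fin m → ℝ≥0 := fun s => (s.1.toNat : ℝ≥0) * ((v s.2).toNNReal)⁻¹ with hwn
  have he : ∫⁻ ω, Wc s0 (fun x y => Ec x y) ω ∂(P s0) ≠ ⊤ := by
    refine Wc_int_fin h L _ 1 ENNReal.one_ne_top fun s => ?_
    by_cases hs : s.1 ≤ 0
    · simp only [Ec, if_pos hs, ENNReal.coe_one, mul_one, PMF.tsum_coe, one_mul]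
      refine le_trans ?_ (hge s hs)
      push_cast
      exact le_self_add
    · simp [Ec, hs]
  have hfx : ∫⁻ ω, Wc s0 (fun x y => Cw (fun x _ => x) wx x y) ω ∂(P s0) ≠ ⊤ := by
    refine Wc_int_fin h L _ a ENNReal.coe_ne_top fun s => ?_
    by_cases hs : s.1 ≤ 0
    · simp only [Cw, if_pos hs]
      rw [ENNReal.tsum_mul_right, PMF.tsum_coe, one_mul]
      have : (wx s : ℝ≥0∞) ≤ a * (s.1.natAbs : ℝ≥0∞) := by
        have : wx s ≤ a * s.1.natAbs := by
          rw [hwx, mul_comm a]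
          exact mul_le_mul_right (ha _) _
        exact_mod_cast this
      refine this.trans (mul_le_mul_right ?_ _)
      refine le_trans ?_ (hge s hs)
      push_cast
      exact le_add_self
    · simp [Cw, hs]
  have hfn : ∫⁻ ω, Wc s0 (fun x y => Cw (fun _ y => y) wn x y) ω ∂(P s0) ≠ ⊤ := by
    refine Wc_int_fin h L _ (a * ENNReal.ofReal C)
      (ENNReal.mul_ne_top ENNReal.coe_ne_top ENNReal.ofReal_ne_top) fun s => ?_
    by_cases hs : s.1 ≤ 0
    · simp only [Cw, if_pos hs]
      have h1 : ∀ y, K s y * (wn y : ℝ≥0∞) ≤ a * ((y.1.toNat : ℝ≥0∞) * K s y) := by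
        intro y
        have : (wn y : ℝ≥0∞) ≤ a * (y.1.toNat : ℝ≥0∞) := by
          have : wn y ≤ a * y.1.toNat := by
            rw [hwn, mul_comm a]
            exact mul_le_mul_right (ha _) _
          exact_mod_cast this
        calc K s y * (wn y : ℝ≥0∞) ≤ K s y * (a * (y.1.toNat : ℝ≥0∞)) := mul_le_mul_right this _
          _ = _ := by ring
      refine (ENNReal.tsum_le_tsum h1).trans ?_
      rw [ENNReal.tsum_mul_left, mul_assoc]
      refine mul_le_mul_right ?_ _
      refine (hA3 s.1 hs s.2).trans ?_
      rw [ENNReal.ofReal_mul hC.le]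
      refine mul_le_mul_right (le_trans ?_ (hge s hs)) _
      rw [← ENNReal.ofReal_natCast]
      refine ENNReal.ofReal_le_ofReal ?_
      push_cast
      rw [Nat.cast_natAbs]
      simp
    · simp [Cw, hs]
  have hinf : ∀ s, ∀ᵐ ω ∂(P s), InfE ω := fun s =>
    (avg_limit h L he he0 Ec (fun x y hx => by simp [Ec, hx]) he s).mono fun ω hω => hω.1
  obtain ⟨hsx, hlx⟩ := weight_limit h L he he0 (fun x _ => x) 0 (fun ω k => rfl)
    (π := πexit) (exit_law h hinf hπexit) wx hfx
  obtain ⟨hsn, hln⟩ := weight_limit h L he he0 (fun _ y => y) 1 (fun ω k => rfl)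
    (π := πent) (ent_law h hinf hπent) wn hfn
  have hwxr : ∀ s : ℤ × Fin m, s.1 ≤ 0 → (wx s : ℝ) = -((s.1 : ℝ) / v s.2) := by
    intro s hs
    have h1 : ((s.1.natAbs : ℕ) : ℝ) = -(s.1 : ℝ) := by
      rw [Nat.cast_natAbs, abs_of_nonpos hs]; push_cast; rfl
    simp only [hwx, NNReal.coe_mul, NNReal.coe_natCast, NNReal.coe_inv, Real.coe_toNNReal _ (hv s.2).le, h1]
    ring
  have hwnr : ∀ s : ℤ × Fin m, 1 ≤ s.1 → (wn s : ℝ) = (s.1 : ℝ) / v s.2 := by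
    intro s hs
    have h1 : ((s.1.toNat : ℕ) : ℝ) = (s.1 : ℝ) := by
      have : ((s.1.toNat : ℕ) : ℤ) = s.1 := Int.toNat_of_nonneg (by omega)
      exact_mod_cast this
    simp only [hwn, NNReal.coe_mul, NNReal.coe_natCast, NNReal.coe_inv, Real.coe_toNNReal _ (hv s.2).le, h1]
    rfl
  have hnz : ∀ s : ℤ × Fin m, ¬ 1 ≤ s.1 → (πent {s}) = 0 := by
    intro s hs
    refine measure_mono_null ?_ hπent.2.1
    intro s' hs'
    have : s' = s := hs'
    rw [this]
    show s.1 ≤ 0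
    omega
  have hxz : ∀ s : ℤ × Fin m, ¬ s.1 ≤ 0 → (πexit {s}) = 0 := by
    intro s hs
    refine measure_mono_null ?_ hπexit.2.1
    intro s' hs'
    have : s' = s := hs'
    rw [this]
    show 1 ≤ s.1
    omega
  have en : ∀ s : ℤ × Fin m, (wn s : ℝ) * (πent {s}).toReal = ((s.1 : ℝ) / v s.2) * (πent {s}).toReal := by
    intro s
    by_cases hs : 1 ≤ s.1
    · rw [hwnr s hs]
    · simp [hnz s hs]
  have ex : ∀ s : ℤ × Fin m, (wx s : ℝ) * (πexit {s}).toReal = -(((s.1 : ℝ) / v s.2) * (πexit {s}).toReal) := by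
    intro s
    by_cases hs : s.1 ≤ 0
    · rw [hwxr s hs]; ring
    · simp [hxz s hs]
  have hμ' : μ = (∑' s, (wn s : ℝ) * (πent {s}).toReal) + ∑' s, (wx s : ℝ) * (πexit {s}).toReal := by
    rw [hμ, tsum_congr en, tsum_congr ex, tsum_neg]; ring
  refine ⟨?_, fun s => ?_⟩
  · rw [hμ']
    refine add_pos_of_pos_of_nonneg ?_ (tsum_nonneg fun s => by positivity)
    obtain ⟨s, hs⟩ : ∃ s, πent {s} ≠ 0 := by
      by_contra hcon
      push Not at hcon
      have : πent Set.univ = 0 := by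
        rw [← Set.iUnion_of_singleton, measure_iUnion_null_iff]
        exact hcon
      simp at this
    refine hsn.tsum_pos (fun s => by positivity) s ?_
    have h1 : 1 ≤ s.1 := by
      by_contra hc
      exact hs (hnz s hc)
    rw [hwnr s h1]
    have h2 : 0 < (πent {s}).toReal := ENNReal.toReal_pos hs (measure_ne_top _ _)
    have h3 : (0 : ℝ) < s.1 := by exact_mod_cast h1
    have := hv s.2
    positivity
  · filter_upwards [hinf s, enter_ae h hA2 s, hlx s, hln s] with ω h1 h2 h3 h4
    rw [hμ']
    refine (h4.add h3).congr fun N => ?_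
    rw [← add_div, ← Finset.sum_add_distrib, div_eq_mul_inv, mul_comm, one_div]
    congr 1
    refine Finset.sum_congr rfl fun ι _ => ?_
    have hx : (ω (sigmaT ι ω)).1 ≤ 0 := by
      rw [sigmaT_eq_nth h1]
      exact Nat.nth_mem_of_infinite (p := fun k => (ω k).1 ≤ 0) h1 ι
    rw [hwnr _ (h2 _ hx), add_zero, hwxr _ hx]
    ring

end Final

end PartF

section PartG
open scoped NNReal

section Walk

theorem sum_pos_part (n : ℕ) : ∀ k : ℤ, ∑ x ∈ Finset.range n, max ((k : ℝ) - x) 0 ≤ (k : ℝ) ^ 2 := by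
  induction n with
  | zero => intro k; simp; positivity
  | succ n ih =>
    intro k
    rw [Finset.sum_range_succ']
    have e : ∀ x : ℕ, (k : ℝ) - ((x + 1 : ℕ) : ℝ) = ((k - 1 : ℤ) : ℝ) - x := by
      intro x; push_cast; ring
    simp_rw [e]
    have h := ih (k - 1)
    rcases le_or_gt k 0 with hk | hk
    · have hk' : (k : ℝ) ≤ 0 := by exact_mod_cast hk
      rw [Finset.sum_eq_zero]
      · rw [max_eq_right (by simpa using hk')]; simp; positivity
      · intro x _
        refine max_eq_right ?_
        push_cast
        have : (0 : ℝ) ≤ x := Nat.cast_nonneg x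
        linarith
    · have hk' : (1 : ℝ) ≤ k := by exact_mod_cast hk
      rw [max_eq_left (a := (k : ℝ) - ((0 : ℕ) : ℝ)) (by simp; linarith)]
      push_cast at h ⊢
      nlinarith

theorem min_bound (x y z : ℝ) : min (x + y) z ≤ min x z + y * (if x < z then 1 else 0) +
    (if z = x then 1 else 0) * min y 0 := by
  rcases lt_trichotomy x z with h | h | h
  · rw [if_pos h, if_neg (ne_of_gt h), min_eq_left h.le]
    simp
  · subst h
    simp only [lt_irrefl, if_false, if_true, min_self, mul_zero, add_zero, one_mul]
    rcases le_total y 0 with h | h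
    · rw [min_eq_left h]; exact min_le_left _ _
    · rw [min_eq_right h]; simp
  · rw [if_neg (not_lt.2 h.le), if_neg (ne_of_lt h), min_eq_right h.le]
    simp

/-- Lyapunov function on the half line -/
noncomputable def Uf (B : ℝ) (ψ : ℤ → ℝ) (t : ℤ) : ℝ := if 1 ≤ t then t + ψ t else B * (1 + |(t : ℝ)|)

theorem walk_lyap (q : ℤ → ℝ) (hq : ∀ y, 0 ≤ q y) (h1 : HasSum q 1)
    (hint : Summable fun y : ℤ => |(y : ℝ)| * q y) (hmean : ∑' y : ℤ, (y : ℝ) * q y = 0)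
    (hsq : Summable fun y : ℤ => (y : ℝ) ^ 2 * q y) (hnd : ∃ y : ℤ, y < 0 ∧ 0 < q y)
    (B : ℝ) (hB : 0 ≤ B) :
    ∃ (z0 : ℕ) (ψ : ℤ → ℝ), (∀ x : ℤ, 0 ≤ x → 0 ≤ ψ x ∧ ψ x ≤ x) ∧
      ∀ x : ℤ, 1 ≤ x → Summable (fun y => q y * Uf B ψ (x + y)) ∧
        ((z0 : ℤ) ≤ x → ∑' y, q y * Uf B ψ (x + y) ≤ Uf B ψ x - (1 / 2) ^ x.toNat) := by
  have hqs : Summable q := h1.summable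
  have hyq : Summable fun y : ℤ => (y : ℝ) * q y :=
    Summable.of_norm_bounded hint fun y => by
      rw [Real.norm_eq_abs, abs_mul, abs_of_nonneg (hq y)]
  -- generic linear growth summability
  have hlin : ∀ f : ℤ → ℝ, ∀ M : ℝ, (∀ y, |f y| ≤ M * (1 + |(y : ℝ)|)) → Summable fun y => q y * f y := by
    intro f M hf
    refine Summable.of_norm_bounded ((hqs.add hint).mul_left M) fun y => ?_
    rw [Real.norm_eq_abs, abs_mul, abs_of_nonneg (hq y)]
    calc q y * |f y| ≤ q y * (M * (1 + |(y : ℝ)|)) := mul_le_mul_of_nonneg_left (hf y) (hq y)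
      _ = _ := by ring
  set w0 : ℝ := ∑' y, q y * (-min (y : ℝ) 0) with hw0
  have hmin : Summable fun y : ℤ => q y * (-min (y : ℝ) 0) := by
    refine hlin _ 1 fun y => ?_
    rw [abs_neg]
    rcases le_total (y : ℝ) 0 with h | h
    · rw [min_eq_left h]; linarith
    · rw [min_eq_right h]; simp; positivity
  have hw0pos : 0 < w0 := by
    obtain ⟨y, hy, hqy⟩ := hnd
    have hy' : (y : ℝ) < 0 := by exact_mod_cast hy
    refine hmin.tsum_pos (fun y => mul_nonneg (hq y) (by simp)) y ?_
    rw [min_eq_left hy'.le]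
    exact mul_pos hqy (by linarith)
  set ab : ℕ → ℝ := fun x => ∑' y : ℤ, q y * max (1 - (x : ℝ) - y) 0 with hab
  have habs : ∀ x : ℝ, Summable fun y : ℤ => q y * max (1 - x - y) 0 := by
    intro x
    refine hlin _ (1 + |x|) fun y => ?_
    rw [abs_of_nonneg (le_max_right _ _)]
    refine max_le ?_ (by positivity)
    have h1 := neg_abs_le (y : ℝ)
    have h2 := neg_abs_le x
    nlinarith [abs_nonneg x, abs_nonneg (y : ℝ), mul_nonneg (abs_nonneg x) (abs_nonneg (y : ℝ))]
  have hab0 : ∀ x, 0 ≤ ab x := fun x => tsum_nonneg fun y => mul_nonneg (hq y) (le_max_right _ _)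
  have habsum : Summable ab := by
    rw [← summable_nat_add_iff 1]
    refine summable_of_sum_range_le (c := ∑' y : ℤ, (y : ℝ) ^ 2 * q y) (fun n => hab0 _) fun n => ?_
    simp only [hab]
    rw [← Summable.tsum_finsetSum (fun i _ => habs _)]
    refine Summable.tsum_le_tsum (fun y => ?_) (summable_sum fun i _ => habs _) hsq
    rw [← Finset.mul_sum, mul_comm]
    refine mul_le_mul_of_nonneg_right ?_ (hq y)
    have := sum_pos_part n (-y)
    push_cast at this ⊢
    have e : ∀ i : ℕ, (1 : ℝ) - (i + 1) - y = -y - i := fun i => by ring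
    simp_rw [e]
    simpa using this
  set e : ℕ → ℝ := fun z => ((B + 2) * ab z + (1 / 2) ^ z) / w0 with he
  have he0 : ∀ z, 0 ≤ e z := fun z => by
    have := hab0 z
    simp only [he]
    positivity
  have hes : Summable e := ((habsum.mul_left _).add (summable_geometric_two)).div_const _
  obtain ⟨z0, hz0⟩ : ∃ z0 : ℕ, ∑' z, e (z + z0) ≤ 1 := by
    have := tendsto_sum_nat_add e
    obtain ⟨z, hz⟩ := (this.eventually_lt_const (zero_lt_one)).exists
    exact ⟨z, hz.le⟩
  set d : ℕ → ℝ := fun z => if z0 ≤ z then e z else 0 with hd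
  have hd0 : ∀ z, 0 ≤ d z := fun z => by
    simp only [hd]
    split_ifs
    · exact he0 z
    · exact le_rfl
  have hds : Summable d := Summable.of_nonneg_of_le hd0 (fun z => by
    simp only [hd]
    split_ifs
    · exact le_rfl
    · exact he0 z) hes
  have hD : ∑' z, d z ≤ 1 := by
    rw [← hds.sum_add_tsum_nat_add z0, Finset.sum_eq_zero, zero_add]
    · refine le_trans (le_of_eq (tsum_congr fun z => ?_)) hz0
      simp [hd]
    · intro z hz
      have : ¬ z0 ≤ z := by simpa using hz
      simp [hd, this]
  set ψ : ℤ → ℝ := fun x => ∑' z : ℕ, d z * min (x : ℝ) z with hψ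
  have hψs : ∀ x : ℝ, Summable fun z : ℕ => d z * min x z := by
    intro x
    refine Summable.of_norm_bounded (hds.mul_left |x|) fun z => ?_
    rw [Real.norm_eq_abs, abs_mul, abs_of_nonneg (hd0 z), mul_comm]
    refine mul_le_mul_of_nonneg_right ?_ (hd0 z)
    rcases le_total x z with h | h
    · rw [min_eq_left h]
    · rw [min_eq_right h, abs_of_nonneg (Nat.cast_nonneg z)]
      exact h.trans (le_abs_self x)
  have hψub : ∀ x : ℤ, 0 ≤ x → 0 ≤ ψ x ∧ ψ x ≤ x := by
    intro x hx
    have hx' : (0 : ℝ) ≤ x := by exact_mod_cast hx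
    refine ⟨tsum_nonneg fun z => mul_nonneg (hd0 z) (le_min hx' (Nat.cast_nonneg z)), ?_⟩
    calc ψ x ≤ ∑' z, d z * x := Summable.tsum_le_tsum
          (fun z => mul_le_mul_of_nonneg_left (min_le_left _ _) (hd0 z)) (hψs x) (hds.mul_right _)
      _ = (∑' z, d z) * x := tsum_mul_right
      _ ≤ 1 * x := mul_le_mul_of_nonneg_right hD hx'
      _ = x := one_mul _
  have hψneg : ∀ x : ℤ, x ≤ 0 → (x : ℝ) ≤ ψ x ∧ ψ x ≤ 0 := by
    intro x hx
    have hx' : (x : ℝ) ≤ 0 := by exact_mod_cast hx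
    have : ψ x = (∑' z, d z) * x := by
      rw [← tsum_mul_right]
      refine tsum_congr fun z => ?_
      rw [min_eq_left (hx'.trans (Nat.cast_nonneg z))]
    have hnn : 0 ≤ ∑' z, d z := tsum_nonneg hd0
    rw [this]
    constructor
    · nlinarith
    · nlinarith
  have hψabs : ∀ x : ℤ, |ψ x| ≤ |(x : ℝ)| := by
    intro x
    rcases le_total 0 x with h | h
    · have h' : (0 : ℝ) ≤ x := by exact_mod_cast h
      rw [abs_of_nonneg (hψub x h).1, abs_of_nonneg h']
      exact (hψub x h).2
    · have h' : (x : ℝ) ≤ 0 := by exact_mod_cast h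
      rw [abs_of_nonpos (hψneg x h).2, abs_of_nonpos h']
      linarith [(hψneg x h).1]
  have hU : ∀ t : ℤ, Uf B ψ t ≤ t + ψ t + (B + 2) * max (1 - (t : ℝ)) 0 := by
    intro t
    unfold Uf
    split_ifs with h
    · have : 0 ≤ (B + 2) * max (1 - (t : ℝ)) 0 := by positivity
      linarith
    · have h0 : t ≤ 0 := by omega
      have h' : (t : ℝ) ≤ 0 := by exact_mod_cast h0
      rw [abs_of_nonpos h', max_eq_left (by linarith)]
      have := (hψneg t h0).1
      nlinarith
  have hUb : ∀ t : ℤ, |Uf B ψ t| ≤ (B + 2) * (1 + |(t : ℝ)|) := by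
    intro t
    have hp := hψabs t
    unfold Uf
    split_ifs with h
    · refine (abs_add_le _ _).trans ?_
      nlinarith [abs_nonneg (t : ℝ), mul_nonneg hB (abs_nonneg (t : ℝ))]
    · rw [abs_of_nonneg (by positivity)]
      nlinarith [abs_nonneg (t : ℝ)]
  refine ⟨z0, ψ, hψub, fun x hx => ?_⟩
  have hgrow : ∀ (f : ℤ → ℝ) (M : ℝ), 0 ≤ M → (∀ t, |f t| ≤ M * (1 + |(t : ℝ)|)) →
      Summable fun y => q y * f (x + y) := by
    intro f M hM hf
    refine hlin (fun y => f (x + y)) (M * (1 + |(x : ℝ)|)) fun y => (hf _).trans ?_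
    rw [mul_assoc]
    refine mul_le_mul_of_nonneg_left ?_ hM
    push_cast
    have := abs_add_le (x : ℝ) y
    nlinarith [mul_nonneg (abs_nonneg (x : ℝ)) (abs_nonneg (y : ℝ))]
  have hUs := hgrow (Uf B ψ) (B + 2) (by positivity) hUb
  refine ⟨hUs, fun hxz => ?_⟩
  obtain ⟨n, rfl⟩ : ∃ n : ℕ, x = n := ⟨x.toNat, by omega⟩
  have hxz' : z0 ≤ n := by exact_mod_cast hxz
  have hψstep : ∀ y : ℤ, ψ (n + y) ≤ ψ n + y * (∑' z : ℕ, d z * (if (n : ℝ) < z then 1 else 0)) +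
      d n * min (y : ℝ) 0 := by
    intro y
    have hs2 : Summable fun z : ℕ => d z * (if (n : ℝ) < z then (1 : ℝ) else 0) := by
      refine Summable.of_nonneg_of_le (fun z => mul_nonneg (hd0 z) (by split_ifs <;> simp)) (fun z => ?_) hds
      split_ifs
      · simp
      · simpa using hd0 z
    have hs3 : HasSum (fun z : ℕ => d z * ((if (z : ℝ) = n then 1 else 0) * min (y : ℝ) 0))
        (d n * min (y : ℝ) 0) := by
      have := hasSum_single (f := fun z : ℕ => d z * ((if (z : ℝ) = n then 1 else 0) * min (y : ℝ) 0)) n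
        (fun z hz => by
          have : ¬ (z : ℝ) = n := by exact_mod_cast hz
          simp [this])
      simpa using this
    have hsum := ((hψs n).add (hs2.mul_left (y : ℝ))).add hs3.summable
    have : ψ (n + y) ≤ ∑' z : ℕ, (d z * min (n : ℝ) z + y * (d z * (if (n : ℝ) < z then 1 else 0)) +
        d z * ((if (z : ℝ) = n then 1 else 0) * min (y : ℝ) 0)) := by
      refine Summable.tsum_le_tsum (fun z => ?_) (hψs _) hsum
      have := mul_le_mul_of_nonneg_left (min_bound n y z) (hd0 z)
      push_cast
      refine this.trans (le_of_eq ?_)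
      ring
    refine this.trans (le_of_eq ?_)
    rw [Summable.tsum_add ((hψs n).add (hs2.mul_left (y : ℝ))) hs3.summable,
      Summable.tsum_add (hψs n) (hs2.mul_left (y : ℝ)), hs3.tsum_eq, tsum_mul_left]
    simp [hψ]
  set Dn : ℝ := ∑' z : ℕ, d z * (if (n : ℝ) < z then 1 else 0) with hDn
  have hrhs : HasSum (fun y : ℤ => q y * ((n : ℝ) + ψ n) + (1 + Dn) * (y * q y) -
      d n * (q y * (-min (y : ℝ) 0)) + (B + 2) * (q y * max (1 - (n : ℝ) - y) 0))
      (1 * ((n : ℝ) + ψ n) + (1 + Dn) * 0 - d n * w0 + (B + 2) * ab n) := by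
    refine HasSum.add (HasSum.sub (HasSum.add (h1.mul_right _) (HasSum.mul_left _ ?_))
      (hmin.hasSum.mul_left _)) ((habs n).hasSum.mul_left _)
    rw [← hmean]; exact hyq.hasSum
  have hle : ∑' y, q y * Uf B ψ (n + y) ≤ 1 * ((n : ℝ) + ψ n) + (1 + Dn) * 0 - d n * w0 + (B + 2) * ab n := by
    rw [← hrhs.tsum_eq]
    refine Summable.tsum_le_tsum (fun y => ?_) hUs hrhs.summable
    have a1 := hU (n + y)
    have a2 := hψstep y
    push_cast at a1
    have e1 : (1 : ℝ) - (n + y) = 1 - n - y := by ring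
    rw [e1] at a1
    have a3 : Uf B ψ (n + y) ≤ n + y + (ψ n + y * Dn + d n * min (y : ℝ) 0) +
      (B + 2) * max (1 - (n : ℝ) - y) 0 := by linarith
    refine (mul_le_mul_of_nonneg_left a3 (hq y)).trans (le_of_eq ?_)
    ring
  refine hle.trans ?_
  have hdn : d n * w0 = (B + 2) * ab n + (1 / 2) ^ n := by
    simp only [hd, if_pos hxz', he]
    field_simp
  have hun : Uf B ψ n = n + ψ n := by
    unfold Uf
    rw [if_pos hx]
    push_cast
    rfl
  rw [hdn, hun]
  simp only [Int.toNat_natCast]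
  linarith

end Walk

end PartG

section PartH
open scoped NNReal

section Base

variable {m : ℕ} {K : ℤ × Fin m → PMF (ℤ × Fin m)}

theorem iterK_succ (n : ℕ) (s : ℤ × Fin m) : iterK K (n + 1) s = (K s).bind (iterK K n) := by
  induction n generalizing s with
  | zero =>
    show (PMF.pure s).bind K = (K s).bind PMF.pure
    rw [PMF.pure_bind, PMF.bind_pure]
  | succ n ih =>
    show (iterK K (n + 1) s).bind K = _
    rw [ih, PMF.bind_bind]
    rfl

/-- probability of avoiding `s0` up to time `n` -/
noncomputable def hav (K : ℤ × Fin m → PMF (ℤ × Fin m)) (s0 : ℤ × Fin m) : ℕ → ℤ × Fin m → ℝ≥0∞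
  | 0, s => if s = s0 then 0 else 1
  | n + 1, s => if s = s0 then 0 else ∑' y, K s y * hav K s0 n y

theorem hav_add (s0 : ℤ × Fin m) (n : ℕ) : ∀ s, hav K s0 n s + iterK K n s s0 ≤ 1 := by
  induction n with
  | zero =>
    intro s
    by_cases h : s = s0
    · simp [hav, h, iterK]
    · simp [hav, h, iterK, PMF.pure_apply, Ne.symm h]
  | succ n ih =>
    intro s
    by_cases h : s = s0
    · simp only [hav, if_pos h, zero_add]
      exact PMF.coe_le_one _ _
    · simp only [hav, if_neg h]
      rw [iterK_succ, PMF.bind_apply, ← ENNReal.tsum_add]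
      calc _ ≤ ∑' y, K s y * 1 := by
            refine ENNReal.tsum_le_tsum fun y => ?_
            rw [← mul_add]
            exact mul_le_mul_right (ih y) _
        _ = 1 := by simp [PMF.tsum_coe]

theorem hav_le_one (s0 : ℤ × Fin m) (n : ℕ) (s : ℤ × Fin m) : hav K s0 n s ≤ 1 :=
  le_self_add.trans (hav_add s0 n s)

theorem hav_succ_le (s0 : ℤ × Fin m) (n : ℕ) : ∀ s, hav K s0 (n + 1) s ≤ hav K s0 n s := by
  induction n with
  | zero =>
    intro s
    by_cases h : s = s0
    · simp [hav, h]
    · have := hav_le_one (K := K) s0 1 s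
      simpa [hav, h] using this
  | succ n ih =>
    intro s
    by_cases h : s = s0
    · simp [hav, h]
    · rw [hav, hav, if_neg h, if_neg h]
      exact ENNReal.tsum_le_tsum fun y => mul_le_mul_right (ih y) _

theorem hav_anti (s0 : ℤ × Fin m) (s : ℤ × Fin m) : Antitone (fun n => hav K s0 n s) :=
  antitone_nat_of_succ_le fun n => hav_succ_le s0 n s

theorem hav_sum (s0 : ℤ × Fin m) (N : ℕ) {s : ℤ × Fin m} (hs : s ≠ s0) :
    (∑' y, K s y * ∑ n ∈ Finset.range N, hav K s0 n y) + 1 =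
      (∑ n ∈ Finset.range N, hav K s0 n s) + hav K s0 N s := by
  have e : (∑' y, K s y * ∑ n ∈ Finset.range N, hav K s0 n y) =
      ∑ n ∈ Finset.range N, hav K s0 (n + 1) s := by
    simp_rw [Finset.mul_sum]
    rw [Summable.tsum_finsetSum (fun _ _ => ENNReal.summable)]
    refine Finset.sum_congr rfl fun n _ => ?_
    rw [hav, if_neg hs]
  have e1 : (1 : ℝ≥0∞) = hav K s0 0 s := by rw [hav, if_neg hs]
  rw [e, e1, ← Finset.sum_range_succ' (fun n => hav K s0 n s) N, Finset.sum_range_succ]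

theorem lyap_of_base (s0 : ℤ × Fin m) (U g : ℤ × Fin m → ℝ≥0∞) (F : Finset (ℤ × Fin m))
    (hU : ∀ s, U s ≠ ⊤) (hg : ∀ s, g s ≠ ⊤) (hg0 : ∀ s, g s ≠ 0)
    (hsub : ∀ M : ℝ≥0, {s | U s ≤ M}.Finite)
    (hKU : ∀ s, ∑' y, K s y * U y ≠ ⊤)
    (hdrift : ∀ s, s ∉ F → (∑' y, K s y * U y) + g s ≤ U s)
    (hF : ∀ s ∈ F, ∃ n, iterK K n s s0 ≠ 0) : ∃ V, Lyap K s0 V g := by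
  choose! t ht using hF
  set N : ℕ := ∑ s ∈ F, t s with hN
  set b : ℝ≥0∞ := ∑ s ∈ F, ((∑' y, K s y * U y) + g s) with hb
  have hbt : b ≠ ⊤ := by
    rw [hb, ENNReal.sum_ne_top]
    intro s _
    exact ENNReal.add_ne_top.2 ⟨hKU s, hg s⟩
  have hlt : ∀ s ∈ F, hav K s0 N s < 1 := by
    intro s hs
    have h1 : t s ≤ N := Finset.single_le_sum (f := t) (fun _ _ => Nat.zero_le _) hs
    refine lt_of_le_of_lt (hav_anti s0 s h1) ?_
    have h2 := hav_add (K := K) s0 (t s) s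
    have h3 : hav K s0 (t s) s ≠ ⊤ := ne_top_of_le_ne_top ENNReal.one_ne_top (hav_le_one s0 _ s)
    exact lt_of_lt_of_le (ENNReal.lt_add_right h3 (ht s hs)) h2
  set A : ℝ≥0∞ := ∑ s ∈ F, b / (1 - hav K s0 N s) with hA
  have hAt : A ≠ ⊤ := by
    rw [hA, ENNReal.sum_ne_top]
    intro s hs
    exact ENNReal.div_ne_top hbt (tsub_pos_of_lt (hlt s hs)).ne'
  have hAF : ∀ s ∈ F, A * hav K s0 N s + b ≤ A := by
    intro s hs
    have h1 : b / (1 - hav K s0 N s) ≤ A :=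
      Finset.single_le_sum (f := fun s => b / (1 - hav K s0 N s)) (fun _ _ => zero_le) hs
    have hd0 : (1 - hav K s0 N s) ≠ 0 := (tsub_pos_of_lt (hlt s hs)).ne'
    have hdt : (1 - hav K s0 N s) ≠ ⊤ := ne_top_of_le_ne_top ENNReal.one_ne_top tsub_le_self
    have h2 : b ≤ A * (1 - hav K s0 N s) := by
      rw [ENNReal.div_le_iff hd0 hdt] at h1
      exact h1
    calc A * hav K s0 N s + b ≤ A * hav K s0 N s + A * (1 - hav K s0 N s) := by gcongr
      _ = A := by rw [← mul_add, add_tsub_cancel_of_le (hlt s hs).le, mul_one]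
  set H : ℤ × Fin m → ℝ≥0∞ := fun s => ∑ n ∈ Finset.range N, hav K s0 n s with hH
  have hHN : ∀ s, H s ≤ N := by
    intro s
    calc H s ≤ ∑ n ∈ Finset.range N, (1 : ℝ≥0∞) := Finset.sum_le_sum fun n _ => hav_le_one s0 n s
      _ = N := by simp
  have hHt : ∀ s, H s ≠ ⊤ := fun s => ne_top_of_le_ne_top (ENNReal.natCast_ne_top N) (hHN s)
  have hKV : ∀ s, ∑' y, K s y * (U y + A * H y) = (∑' y, K s y * U y) + A * ∑' y, K s y * H y := by
    intro s
    rw [← ENNReal.tsum_mul_left, ← ENNReal.tsum_add]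
    refine tsum_congr fun y => ?_
    ring
  have hKH : ∀ s, ∑' y, K s y * H y ≤ N := by
    intro s
    calc _ ≤ ∑' y, K s y * (N : ℝ≥0∞) := ENNReal.tsum_le_tsum fun y => mul_le_mul_right (hHN y) _
      _ = N := by rw [ENNReal.tsum_mul_right, PMF.tsum_coe, one_mul]
  refine ⟨fun s => U s + A * H s, ?_, hg, hg0, ?_, ?_, ?_⟩
  · intro s
    exact ENNReal.add_ne_top.2 ⟨hU s, ENNReal.mul_ne_top hAt (hHt s)⟩
  · intro M
    refine (hsub M).subset fun s hs => ?_
    have hs' : U s + A * H s ≤ M := hs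
    exact le_self_add.trans hs'
  · intro s hs
    rw [hKV]
    have hsum := hav_sum (K := K) s0 N hs
    have hht : hav K s0 N s ≠ ⊤ := ne_top_of_le_ne_top ENNReal.one_ne_top (hav_le_one s0 _ s)
    change (∑' y, K s y * H y) + 1 = H s + hav K s0 N s at hsum
    by_cases hsF : s ∈ F
    · have h1 : (∑' y, K s y * U y) + g s ≤ b :=
        Finset.single_le_sum (f := fun s => (∑' y, K s y * U y) + g s) (fun _ _ => zero_le) hsF
      have h2 := hAF s hsF
      have h3 : A * (∑' y, K s y * H y) + A = A * H s + A * hav K s0 N s := by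
        rw [← mul_add, ← hsum, mul_add, mul_one]
      have h4 : A * (∑' y, K s y * H y) + b ≤ A * H s := by
        have hf : A * hav K s0 N s ≠ ⊤ := ENNReal.mul_ne_top hAt hht
        refine (ENNReal.add_le_add_iff_right hf).1 ?_
        calc A * (∑' y, K s y * H y) + b + A * hav K s0 N s
            = A * (∑' y, K s y * H y) + (A * hav K s0 N s + b) := by ring
          _ ≤ A * (∑' y, K s y * H y) + A := by gcongr
          _ = _ := h3
      calc _ = A * (∑' y, K s y * H y) + ((∑' y, K s y * U y) + g s) := by ring
        _ ≤ A * (∑' y, K s y * H y) + b := by gcongr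
        _ ≤ A * H s := h4
        _ ≤ _ := le_add_self
    · have h1 := hdrift s hsF
      have h2 : ∑' y, K s y * H y ≤ H s := by
        refine (ENNReal.add_le_add_iff_right ENNReal.one_ne_top).1 ?_
        rw [hsum]
        gcongr
        exact hav_le_one s0 N s
      calc _ = ((∑' y, K s y * U y) + g s) + A * ∑' y, K s y * H y := by ring
        _ ≤ U s + A * H s := by gcongr
  · rw [hKV]
    exact ENNReal.add_ne_top.2 ⟨hKU s0, ENNReal.mul_ne_top hAt
      (ne_top_of_le_ne_top (ENNReal.natCast_ne_top N) (hKH s0))⟩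

theorem K_walk {x : ℤ} {i : Fin m} {ξ : PMF ℤ} (hA1 : ∀ y, K (x, i) (x + y, i) = ξ y)
    (f : ℤ × Fin m → ℝ≥0∞) : ∑' s, K (x, i) s * f s = ∑' y, ξ y * f (x + y, i) := by
  set e : ℤ → ℤ × Fin m := fun y => (x + y, i) with he
  have hinj : Function.Injective e := by
    intro a b hab
    simp only [he, Prod.mk.injEq, add_right_inj, and_true] at hab
    exact hab
  have hz : ∀ s, s ∉ Set.range e → K (x, i) s = 0 := by
    have h1 := ENNReal.summable.tsum_add_tsum_compl (f := fun s => K (x, i) s) (s := Set.range e)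
      ENNReal.summable
    rw [PMF.tsum_coe, tsum_range (fun s => K (x, i) s) hinj] at h1
    have h2 : ∑' y, K (x, i) (e y) = 1 := by
      rw [← ξ.tsum_coe]
      exact tsum_congr hA1
    rw [h2] at h1
    have h3 : ∑' s : ((Set.range e)ᶜ : Set (ℤ × Fin m)), K (x, i) s = 0 :=
      by
      refine (ENNReal.add_right_inj ENNReal.one_ne_top).1 ?_
      rw [h1, add_zero]
    intro s hs
    exact ENNReal.tsum_eq_zero.1 h3 ⟨s, hs⟩
  rw [← hinj.tsum_eq (f := fun s => K (x, i) s * f s)]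
  · exact tsum_congr fun y => by rw [← hA1 y]
  · intro s hs
    by_contra hc
    exact hs (by simp [hz s hc])

theorem exists_lyap
    (ξ : Fin m → PMF ℤ)
    (hA1 : ∀ x : ℤ, 1 ≤ x → ∀ (i : Fin m) (y : ℤ), K (x, i) (x + y, i) = ξ i y)
    (hint : ∀ i, Summable fun y : ℤ => |(y : ℝ)| * (ξ i y).toReal)
    (hmean : ∀ i, ∑' y : ℤ, (y : ℝ) * (ξ i y).toReal = 0)
    (hsq : ∀ i, Summable fun y : ℤ => (y : ℝ) ^ 2 * (ξ i y).toReal)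
    (hneg : ∀ i, ∃ y : ℤ, y < 0 ∧ ξ i y ≠ 0)
    (hA2 : ∀ x : ℤ, x ≤ 0 → ∀ i : Fin m, ∀ s' : ℤ × Fin m, K (x, i) s' ≠ 0 → 1 ≤ s'.1)
    (C : ℝ) (hC : 0 < C)
    (hA3 : ∀ x : ℤ, x ≤ 0 → ∀ i : Fin m,
      ∑' s' : ℤ × Fin m, (s'.1.toNat : ℝ≥0∞) * K (x, i) s' ≤
        ENNReal.ofReal (C * (1 + |(x : ℝ)|)))
    (hA4 : ∀ s s' : ℤ × Fin m, 1 ≤ s.1 → 1 ≤ s'.1 → ∃ n : ℕ, iterK K n s s' ≠ 0)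
    (s0 : ℤ × Fin m) (hs0 : 1 ≤ s0.1) :
    ∃ V g, Lyap K s0 V g ∧ ∀ s, s.1 ≤ 0 → ((1 + s.1.natAbs : ℕ) : ℝ≥0∞) ≤ g s := by
  set B : ℝ := 2 * C + 1 with hB
  have hB0 : 0 ≤ B := by positivity
  have hw := fun i => walk_lyap (fun y => (ξ i y).toReal) (fun y => ENNReal.toReal_nonneg)
    (by
      have h1 : ∑' y, ξ i y ≠ ⊤ := by rw [PMF.tsum_coe]; exact ENNReal.one_ne_top
      have h2 := (ENNReal.summable_toReal h1).hasSum
      rw [← ENNReal.tsum_toReal_eq (fun y => PMF.apply_ne_top _ _), PMF.tsum_coe] at h2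
      simpa using h2)
    (hint i) (hmean i) (hsq i)
    (by
      obtain ⟨y, h1, h2⟩ := hneg i
      exact ⟨y, h1, ENNReal.toReal_pos h2 (PMF.apply_ne_top _ _)⟩) B hB0
  choose z0 ψ hψ hstep using hw
  set Z : ℕ := ∑ i, z0 i with hZ
  have hzZ : ∀ i, z0 i ≤ Z := fun i =>
    Finset.single_le_sum (f := z0) (fun _ _ => Nat.zero_le _) (Finset.mem_univ i)
  set Ur : ℤ × Fin m → ℝ := fun s => Uf B (ψ s.2) s.1 with hUr
  have hUabs : ∀ s : ℤ × Fin m, |(s.1 : ℝ)| ≤ Ur s := by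
    intro s
    simp only [hUr, Uf]
    split_ifs with h
    · have := (hψ s.2 s.1 (by omega)).1
      have h' : (0 : ℝ) ≤ s.1 := by
        have : (0 : ℤ) ≤ s.1 := by omega
        exact_mod_cast this
      rw [abs_of_nonneg h']
      linarith
    · have := abs_nonneg (s.1 : ℝ)
      nlinarith
  have hUnn : ∀ s, 0 ≤ Ur s := fun s => (abs_nonneg _).trans (hUabs s)
  have hU2 : ∀ s : ℤ × Fin m, 1 ≤ s.1 → ENNReal.ofReal (Ur s) ≤ 2 * (s.1.toNat : ℝ≥0∞) := by
    intro s hs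
    have h1 : ((s.1.toNat : ℕ) : ℝ) = (s.1 : ℝ) := by
      have : ((s.1.toNat : ℕ) : ℤ) = s.1 := Int.toNat_of_nonneg (by omega)
      exact_mod_cast this
    have : (2 : ℝ≥0∞) * (s.1.toNat : ℝ≥0∞) = ENNReal.ofReal ((2 * s.1.toNat : ℕ) : ℝ) := by
      rw [ENNReal.ofReal_natCast]; push_cast; rfl
    rw [this]
    refine ENNReal.ofReal_le_ofReal ?_
    push_cast
    rw [h1]
    simp only [hUr, Uf, if_pos hs]
    linarith [(hψ s.2 s.1 (by omega)).2]
  have hK1 : ∀ (x : ℤ) (i : Fin m), 1 ≤ x → ∑' s, K (x, i) s * ENNReal.ofReal (Ur s) =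
      ENNReal.ofReal (∑' y, (ξ i y).toReal * Uf B (ψ i) (x + y)) := by
    intro x i hx
    rw [K_walk (hA1 x hx i), ENNReal.ofReal_tsum_of_nonneg _ (hstep i x hx).1]
    · refine tsum_congr fun y => ?_
      rw [ENNReal.ofReal_mul ENNReal.toReal_nonneg, ENNReal.ofReal_toReal (PMF.apply_ne_top _ _)]
    · intro y
      exact mul_nonneg ENNReal.toReal_nonneg (hUnn (x + y, i))
  have hK0 : ∀ (x : ℤ) (i : Fin m), x ≤ 0 → ∑' s, K (x, i) s * ENNReal.ofReal (Ur s) ≤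
      2 * ENNReal.ofReal (C * (1 + |(x : ℝ)|)) := by
    intro x i hx
    refine le_trans ?_ (mul_le_mul_right (hA3 x hx i) 2)
    rw [← ENNReal.tsum_mul_left]
    refine ENNReal.tsum_le_tsum fun s => ?_
    by_cases hK : K (x, i) s = 0
    · simp [hK]
    · refine (mul_le_mul_right (hU2 s (hA2 x hx i s hK)) _).trans (le_of_eq ?_)
      ring
  set g : ℤ × Fin m → ℝ≥0∞ := fun s => if s.1 ≤ 0 then ((1 + s.1.natAbs : ℕ) : ℝ≥0∞)
    else ENNReal.ofReal ((1 / 2) ^ s.1.toNat) with hg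
  suffices hex : ∃ V, Lyap K s0 V g by
    obtain ⟨V, hV⟩ := hex
    refine ⟨V, g, hV, fun s hs => ?_⟩
    simp only [hg, if_pos hs]
    exact le_rfl
  refine lyap_of_base (K := K) s0 (fun s => ENNReal.ofReal (Ur s)) g
    ((Finset.Icc (1 : ℤ) Z) ×ˢ Finset.univ) (fun s => ENNReal.ofReal_ne_top) ?_ ?_ ?_ ?_ ?_ ?_
  · intro s
    simp only [hg]
    split_ifs
    · exact ENNReal.natCast_ne_top _
    · exact ENNReal.ofReal_ne_top
  · intro s
    simp only [hg]
    split_ifs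
    · exact Nat.cast_ne_zero.2 (by omega)
    · rw [Ne, ENNReal.ofReal_eq_zero, not_le]
      positivity
  · intro M
    obtain ⟨n, hn⟩ := exists_nat_ge (M : ℝ)
    refine ((Finset.Icc (-(n : ℤ)) n) ×ˢ (Finset.univ : Finset (Fin m))).finite_toSet.subset ?_
    intro s hs
    have h1 : ENNReal.ofReal (Ur s) ≤ M := hs
    rw [← ENNReal.ofReal_coe_nnreal, ENNReal.ofReal_le_ofReal_iff M.coe_nonneg] at h1
    have h2 : |(s.1 : ℝ)| ≤ n := (hUabs s).trans (h1.trans hn)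
    rw [abs_le] at h2
    have h3 : -(n : ℤ) ≤ s.1 := by exact_mod_cast h2.1
    have h4 : s.1 ≤ n := by exact_mod_cast h2.2
    simp [h3, h4]
  · rintro ⟨x, i⟩
    rcases le_or_gt x 0 with h | h
    · exact ne_top_of_le_ne_top (ENNReal.mul_ne_top (by simp) ENNReal.ofReal_ne_top) (hK0 x i h)
    · rw [hK1 x i (by omega)]
      exact ENNReal.ofReal_ne_top
  · rintro ⟨x, i⟩ hs
    rcases le_or_gt x 0 with h | h
    · simp only [hg, if_pos h]
      refine (add_le_add_left (hK0 x i h) _).trans ?_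
      have e1 : (2 : ℝ≥0∞) = ENNReal.ofReal 2 := by simp
      rw [e1, ← ENNReal.ofReal_mul (by norm_num), ← ENNReal.ofReal_natCast,
        ← ENNReal.ofReal_add (by positivity) (by positivity)]
      refine ENNReal.ofReal_le_ofReal ?_
      simp only [hUr, Uf, if_neg (show ¬ 1 ≤ x by omega)]
      push_cast
      rw [Nat.cast_natAbs]
      push_cast
      rw [hB]
      linarith
    · have hx : 1 ≤ x := by omega
      have hxZ : (Z : ℤ) < x := by
        by_contra hc
        apply hs
        simp only [Finset.mem_product, Finset.mem_Icc, Finset.mem_univ, and_true]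
        exact ⟨hx, by omega⟩
      have hz : (z0 i : ℤ) ≤ x := by
        have : (z0 i : ℤ) ≤ Z := by exact_mod_cast hzZ i
        omega
      have h1 := (hstep i x hx).2 hz
      rw [hK1 x i hx]
      simp only [hg, if_neg (show ¬ x ≤ 0 by omega)]
      rw [← ENNReal.ofReal_add (tsum_nonneg fun y =>
        mul_nonneg ENNReal.toReal_nonneg (hUnn (x + y, i))) (by positivity)]
      refine ENNReal.ofReal_le_ofReal ?_
      simp only [hUr]
      linarith
  · rintro ⟨x, i⟩ hs
    simp only [Finset.mem_product, Finset.mem_Icc, Finset.mem_univ, and_true] at hs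
    exact hA4 _ _ hs.1 hs0

theorem neg_step (q : ℤ → ℝ) (hq : ∀ y, 0 ≤ q y)
    (hint : Summable fun y : ℤ => |(y : ℝ)| * q y)
    (hmean : ∑' y : ℤ, (y : ℝ) * q y = 0) (hvar : 0 < ∑' y : ℤ, (y : ℝ) ^ 2 * q y) :
    ∃ y : ℤ, y < 0 ∧ q y ≠ 0 := by
  by_contra hc
  push Not at hc
  have hyq : Summable fun y : ℤ => (y : ℝ) * q y :=
    Summable.of_norm_bounded hint fun y => by
      rw [Real.norm_eq_abs, abs_mul, abs_of_nonneg (hq y)]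
  have hnn : ∀ y : ℤ, 0 ≤ (y : ℝ) * q y := by
    intro y
    rcases lt_or_ge y 0 with h | h
    · rw [hc y h]; simp
    · exact mul_nonneg (by exact_mod_cast h) (hq y)
  have hz : ∀ y : ℤ, (y : ℝ) * q y = 0 := by
    have := hyq.hasSum
    rw [hmean, hasSum_zero_iff_of_nonneg hnn] at this
    exact fun y => congrFun this y
  have : ∑' y : ℤ, (y : ℝ) ^ 2 * q y = 0 := by
    rw [← tsum_zero (α := ℝ) (β := ℤ)]
    refine tsum_congr fun y => ?_
    rw [pow_two, mul_assoc, hz y, mul_zero]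
  linarith

end Base

end PartH

/-- Ergodic averages of the entrance–exit increments: for every
deterministic initial state, almost surely
`(1/N) Σ_{ι=1}^N (R(τ_ι)/v_{l(τ_ι)} − R(σ_ι)/v_{l(σ_ι)}) → μ ∈ (0,∞)`. -/
theorem stmt_4
    (m : ℕ) (hm : 1 ≤ m)
    (K : ℤ × Fin m → PMF (ℤ × Fin m))
    (P : ℤ × Fin m → Measure (ℕ → ℤ × Fin m))
    (hprob : ∀ s, IsProbabilityMeasure (P s))
    -- `P s` is the law of the Markov chain with kernel `K` started at `s`
    (hcyl : ∀ (s : ℤ × Fin m) (n : ℕ) (path : ℕ → ℤ × Fin m),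
      P s {ω | ∀ k ≤ n, ω k = path k} =
        (if path 0 = s then 1 else 0) *
          ∏ k ∈ Finset.range n, K (path k) (path (k + 1)))
    -- (A1): on `ℕ × {i}` the radius jumps like a centered square-integrable
    -- 1-arithmetic random walk with step distribution `ξ i`, variance `(v i)²`
    (ξ : Fin m → PMF ℤ) (v : Fin m → ℝ) (hv : ∀ i, 0 < v i)
    (hA1 : ∀ x : ℤ, 1 ≤ x → ∀ (i : Fin m) (y : ℤ), K (x, i) (x + y, i) = ξ i y)
    (hint : ∀ i, Summable fun y : ℤ => |(y : ℝ)| * (ξ i y).toReal)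
    (hmean : ∀ i, ∑' y : ℤ, (y : ℝ) * (ξ i y).toReal = 0)
    (hsq : ∀ i, Summable fun y : ℤ => (y : ℝ) ^ 2 * (ξ i y).toReal)
    (hvar : ∀ i, (v i) ^ 2 = ∑' y : ℤ, (y : ℝ) ^ 2 * (ξ i y).toReal)
    (harith : ∀ i, ∀ n : ℕ, 1 ≤ n →
      (∀ y : ℤ, ξ i y ≠ 0 → (n : ℤ) ∣ y) → n = 1)
    -- (A2): from a non-positive radius the chain jumps to `ℕ × {1,…,m}` a.s.
    (hA2 : ∀ x : ℤ, x ≤ 0 → ∀ i : Fin m, ∀ s' : ℤ × Fin m,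
      K (x, i) s' ≠ 0 → 1 ≤ s'.1)
    -- (A3): `E[R(1) | 𝒳(0) = (x,i)] ≤ C (1 + |x|)` for `x ≤ 0`
    (C : ℝ) (hC : 0 < C)
    (hA3 : ∀ x : ℤ, x ≤ 0 → ∀ i : Fin m,
      ∑' s' : ℤ × Fin m, (s'.1.toNat : ℝ≥0∞) * K (x, i) s' ≤
        ENNReal.ofReal (C * (1 + |(x : ℝ)|)))
    -- (A4): the states `ℕ × {1,…,m}` communicate
    (hA4 : ∀ s s' : ℤ × Fin m, 1 ≤ s.1 → 1 ≤ s'.1 → ∃ n : ℕ, iterK K n s s' ≠ 0)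
    (πexit πent : Measure (ℤ × Fin m))
    (hπexit : ExitStationary P πexit) (hπent : EntranceStationary P πent)
    (μ : ℝ)
    (hμ : μ = (∑' s : ℤ × Fin m, ((s.1 : ℝ) / v s.2) * (πent {s}).toReal) -
      (∑' s : ℤ × Fin m, ((s.1 : ℝ) / v s.2) * (πexit {s}).toReal)) :
    0 < μ ∧
    ∀ s₀ : ℤ × Fin m, ∀ᵐ ω ∂(P s₀),
      Tendsto (fun N : ℕ => (1 / (N : ℝ)) *
          ∑ ι ∈ Finset.range N,
            (((ω (sigmaT ι ω + 1)).1 : ℝ) / v (ω (sigmaT ι ω + 1)).2 -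
              ((ω (sigmaT ι ω)).1 : ℝ) / v (ω (sigmaT ι ω)).2))
        atTop (nhds μ) := by
  have h : MC K P := by
    refine ⟨hprob, ?_, ?_⟩
    · intro s n path hne
      rw [hcyl, if_neg hne, zero_mul]
    · intro n path
      rw [hcyl, if_pos rfl, one_mul]
  have hneg : ∀ i, ∃ y : ℤ, y < 0 ∧ ξ i y ≠ 0 := by
    intro i
    obtain ⟨y, hy, hqy⟩ := neg_step (fun y => (ξ i y).toReal) (fun y => ENNReal.toReal_nonneg)
      (hint i) (hmean i) (by
        have h1 := hvar i
        have h2 := hv i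
        rw [← h1]
        positivity)
    refine ⟨y, hy, fun h0 => hqy ?_⟩
    simp only [h0, ENNReal.toReal_zero]
  have i0 : Fin m := ⟨0, hm⟩
  obtain ⟨V, g, L, hge⟩ := exists_lyap ξ hA1 hint hmean hsq hneg hA2 C hC hA3 hA4 (1, i0) le_rfl
  obtain ⟨y, hy, hξ⟩ := hneg i0
  have he0 := exit_pos h (s0 := (1, i0)) (y := (1 + y, i0)) le_rfl
    (show 1 + y ≤ 0 by omega) (by rw [hA1 1 le_rfl]; exact hξ)
  exact final_of_lyap h v hv hA2 C hC hA3 L hge he0 πexit πent hπexit hπent μ hμ
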